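/- arXiv:0907.2744 — 3 statements merged into one kernel-verified Lean document; each statement's English description precedes it below -/
import Mathlib

section
/- Let Q be a compact Hausdorff space, A a function algebra on Q, and η a regular Borel probability measure on Q that is multiplicative on A. Then the support of η is a set of antisymmetry for A; that is, every f ∈ A that takes only real values on supp η is constant on supp η. -/
open MeasureTheory

/-- The (closed) support of a measure: points all of whose open neighbourhoods
have positive measure. -/
def measSupport {Q : Type*} [TopologicalSpace Q] [MeasurableSpace Q] (η : Measure Q) :
    Set Q :=
  {x | ∀ U : Set Q, IsOpen U → x ∈ U → η U ≠ 0}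

/-- If `η` is a regular Borel probability measure on a compact Hausdorff space `Q`
which is multiplicative on a function algebra `A ⊆ C(Q)`, then the support of `η`
is a set of antisymmetry for `A`: every `f ∈ A` that is real-valued on `supp η`
is constant on `supp η`. -/
theorem support_of_multiplicative_measure_is_antisymmetry_set
    {Q : Type*} [TopologicalSpace Q] [CompactSpace Q] [T2Space Q]
    [MeasurableSpace Q] [BorelSpace Q]
    (A : Subalgebra ℂ C(Q, ℂ)) (hA : IsClosed (A : Set C(Q, ℂ)))
    (η : Measure Q) [IsProbabilityMeasure η] [η.Regular]
    (hmult : ∀ f ∈ A, ∀ g ∈ A,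
      ∫ x, (f : C(Q, ℂ)) x * (g : C(Q, ℂ)) x ∂η =
        (∫ x, (f : C(Q, ℂ)) x ∂η) * ∫ x, (g : C(Q, ℂ)) x ∂η)
    (f : C(Q, ℂ)) (hf : f ∈ A)
    (hreal : ∀ x ∈ measSupport η, (f x).im = 0) :
    ∀ x ∈ measSupport η, ∀ y ∈ measSupport η, f x = f y := by
  have hae : ∀ᵐ x ∂η, (f x).im = 0 := by
    filter_upwards [Measure.support_mem_ae_of_regular (μ := η)] with x hx
    apply hreal
    intro U hU hxU
    exact ((Measure.mem_support_iff_forall x).1 hx U (hU.mem_nhds hxU)).ne'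
  have hfu : ∀ᵐ x ∂η, f x = (((f x).re : ℝ) : ℂ) := by
    filter_upwards [hae] with x hx
    exact Complex.ext (by simp) (by simp [hx])
  obtain ⟨r, hr⟩ : ∃ r : ℝ, ∫ x, f x ∂η = (r : ℂ) :=
    ⟨∫ x, (f x).re ∂η, by rw [integral_congr_ae hfu, integral_complex_ofReal]⟩
  have hg : f - algebraMap ℂ C(Q, ℂ) (r : ℂ) ∈ A := A.sub_mem hf (A.algebraMap_mem _)
  have hint : Integrable (fun x => f x) η :=
    f.continuous.integrable_of_hasCompactSupport (HasCompactSupport.of_compactSpace _)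
  have hg0 : ∫ x, (f - algebraMap ℂ C(Q, ℂ) (r : ℂ)) x ∂η = 0 := by
    have : ∀ x, (f - algebraMap ℂ C(Q, ℂ) (r : ℂ)) x = f x - (r : ℂ) := by
      intro x; simp
    simp_rw [this]
    rw [integral_sub hint (integrable_const _), hr]
    simp
  have h1 := hmult _ hg _ hg
  rw [hg0, zero_mul] at h1
  have hsq : ∀ᵐ x ∂η, (f - algebraMap ℂ C(Q, ℂ) (r : ℂ)) x *
      (f - algebraMap ℂ C(Q, ℂ) (r : ℂ)) x = ((((f x).re - r) ^ 2 : ℝ) : ℂ) := by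
    filter_upwards [hfu] with x hx
    have : (f - algebraMap ℂ C(Q, ℂ) (r : ℂ)) x = f x - (r : ℂ) := by simp
    rw [this]
    push_cast
    rw [← hx]
    ring
  rw [integral_congr_ae hsq, integral_complex_ofReal, Complex.ofReal_eq_zero] at h1
  have hcont : Continuous fun x => ((f x).re - r) ^ 2 := by fun_prop
  rw [integral_eq_zero_iff_of_nonneg (fun x => sq_nonneg _)
    (hcont.integrable_of_hasCompactSupport (HasCompactSupport.of_compactSpace _))] at h1
  have hfin : ∀ᵐ x ∂η, f x = (r : ℂ) := by
    filter_upwards [hfu, h1] with x hx hx1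
    have h2 : (f x).re - r = 0 := pow_eq_zero_iff (two_ne_zero) |>.1 hx1
    rw [hx, sub_eq_zero.1 h2]
  have hkey : ∀ x ∈ measSupport η, f x = (r : ℂ) := by
    intro x hx
    by_contra hne
    exact hx {y | f y ≠ (r : ℂ)} (isOpen_ne_fun f.continuous continuous_const) hne
      (ae_iff.1 hfin)
  intro x hx y hy
  rw [hkey x hx, hkey y hy]
end

section
/- Let V be a finite-dimensional complex vector space, G a compact connected subgroup of GL(V) such that V contains no nonzero G-fixed vectors, v ∈ V, and M = G·v. Assume (G, Stab_G(v)) is a Gelfand pair, where Stab_G(v) = {g ∈ G : g v = v}. Let N = {w ∈ V : p(w) = 0 for every G-invariant polynomial p on V with p(0) = 0}. Then the algebra P(M) is antisymmetric if and only if v ∈ N; moreover, if v ∈ N then the polynomially convex hull M̂ of M is contained in N. -/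
open MeasureTheory MulAction

/-- `(G, H)` is a Gelfand pair w.r.t. the Haar probability measure `ν`:
any two continuous bi-`H`-invariant functions commute under convolution. -/
def IsGelfandPair {G : Type*} [Group G] [TopologicalSpace G] [MeasurableSpace G]
    (ν : Measure G) (H : Subgroup G) : Prop :=
  ∀ f₁ f₂ : G → ℂ, Continuous f₁ → Continuous f₂ →
    (∀ h₁ ∈ H, ∀ h₂ ∈ H, ∀ g : G, f₁ (h₁ * g * h₂) = f₁ g) →
    (∀ h₁ ∈ H, ∀ h₂ ∈ H, ∀ g : G, f₂ (h₁ * g * h₂) = f₂ g) →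
    ∀ g : G, ∫ k, f₁ k * f₂ (k⁻¹ * g) ∂ν = ∫ k, f₂ k * f₁ (k⁻¹ * g) ∂ν

/-- The algebra of (holomorphic) polynomials on a complex vector space `V`:
the subalgebra of functions generated by the `ℂ`-linear functionals
(and the constants). -/
noncomputable def polyAlg (V : Type*) [AddCommGroup V] [Module ℂ V] : Subalgebra ℂ (V → ℂ) :=
  Algebra.adjoin ℂ {f : V → ℂ | ∃ l : V →ₗ[ℂ] ℂ, f = ⇑l}

/-- The restrictions of polynomials on `V` to a subset `K`, as continuous functions. -/
def polyRestrict (V : Type*) [NormedAddCommGroup V] [NormedSpace ℂ V] (K : Set V) :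
    Set C(K, ℂ) :=
  {f | ∃ p ∈ polyAlg V, ∀ x : K, f x = p (x : V)}

/-- The polynomially convex hull of a subset `K` of `V`. -/
def polyHull {V : Type*} [NormedAddCommGroup V] [NormedSpace ℂ V] (K : Set V) : Set V :=
  {w | ∀ p ∈ polyAlg V, ‖p w‖ ≤ ⨆ z : K, ‖p (z : V)‖}

section OrbitHelpers

theorem aux_integrable {G : Type*} [TopologicalSpace G] [CompactSpace G]
    [MeasurableSpace G] [BorelSpace G] (ν : Measure G) [IsProbabilityMeasure ν]
    {W : Type*} [NormedAddCommGroup W] (F : G → W) (hF : Continuous F) : Integrable F ν :=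
  hF.integrable_of_hasCompactSupport (HasCompactSupport.of_compactSpace F)

/-- Integration as a linear functional on `C(G, ℂ)`. -/
noncomputable def auxInt {G : Type*} [TopologicalSpace G] [CompactSpace G]
    [MeasurableSpace G] [BorelSpace G] (ν : Measure G) [IsProbabilityMeasure ν] :
    C(G, ℂ) →ₗ[ℂ] ℂ where
  toFun f := ∫ x, f x ∂ν
  map_add' f g := by
    simpa using integral_add (aux_integrable ν _ f.continuous) (aux_integrable ν _ g.continuous)
  map_smul' c f := by
    simpa using integral_const_mul c (fun x => f x)

theorem auxInt_apply {G : Type*} [TopologicalSpace G] [CompactSpace G]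
    [MeasurableSpace G] [BorelSpace G] (ν : Measure G) [IsProbabilityMeasure ν] (f : C(G, ℂ)) :
    auxInt ν f = ∫ x, f x ∂ν := rfl

theorem auxInt_star {G : Type*} [TopologicalSpace G] [CompactSpace G]
    [MeasurableSpace G] [BorelSpace G] (ν : Measure G) [IsProbabilityMeasure ν] (f : C(G, ℂ)) :
    auxInt ν (star f) = star (auxInt ν f) := by
  simpa [auxInt_apply] using integral_conj (μ := ν) (f := fun x => f x)

theorem auxInt_one {G : Type*} [TopologicalSpace G] [CompactSpace G]
    [MeasurableSpace G] [BorelSpace G] (ν : Measure G) [IsProbabilityMeasure ν] :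
    auxInt ν 1 = 1 := by
  simp [auxInt_apply]

theorem auxInt_continuous {G : Type*} [TopologicalSpace G] [CompactSpace G]
    [MeasurableSpace G] [BorelSpace G] (ν : Measure G) [IsProbabilityMeasure ν] :
    Continuous (auxInt ν) := by
  refine (LinearMap.mkContinuous (auxInt ν) 1 (fun f => ?_)).continuous
  rw [auxInt_apply, one_mul]
  have := norm_integral_le_of_norm_le_const (μ := ν) (f := fun x => f x) (C := ‖f‖)
    (Filter.Eventually.of_forall fun x => f.norm_coe_le_norm x)
  simpa using this

/-- Orthonormal bases of finite-dimensional spaces of continuous functions. -/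
theorem aux_onb {G : Type*} [TopologicalSpace G] [CompactSpace G]
    [MeasurableSpace G] [BorelSpace G] (ν : Measure G) [IsProbabilityMeasure ν]
    [ν.IsOpenPosMeasure] (E : Submodule ℂ C(G, ℂ)) [FiniteDimensional ℂ E] :
    ∃ (n : ℕ) (e : Fin n → C(G, ℂ)), (∀ i, e i ∈ E) ∧
      ∀ f ∈ E, f = ∑ i, auxInt ν (f * star (e i)) • e i := by
  let J : C(G, ℂ) →ₗ[ℂ] Lp ℂ 2 ν := (ContinuousMap.toLp 2 ν ℂ).toLinearMap
  have hJ : Function.Injective J := ContinuousMap.toLp_injective (p := 2) (E := ℂ) (𝕜 := ℂ) ν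
  let E' : Submodule ℂ (Lp ℂ 2 ν) := E.map J
  have : FiniteDimensional ℂ E' := inferInstanceAs (FiniteDimensional ℂ (E.map J))
  let b := stdOrthonormalBasis ℂ E'
  have hb : ∀ i, ∃ e ∈ E, J e = b i := fun i => (b i).2
  choose e heE he using hb
  refine ⟨_, e, heE, fun f hf => hJ ?_⟩
  have h := b.sum_repr' ⟨J f, Submodule.mem_map_of_mem hf⟩
  have h' := congrArg Subtype.val h
  simp only [Submodule.coe_sum, Submodule.coe_smul, Submodule.coe_inner, ← he] at h'
  rw [map_sum]
  simp only [map_smul]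
  rw [← h']
  refine Finset.sum_congr rfl fun i _ => ?_
  congr 1
  exact ContinuousMap.inner_toLp ν (e i) f

theorem aux_core {G : Type*} [Group G] [TopologicalSpace G] [IsTopologicalGroup G]
    [CompactSpace G] [MeasurableSpace G] [BorelSpace G] (ν : Measure G) [ν.IsHaarMeasure]
    [IsProbabilityMeasure ν] (H : Subgroup G) (hG : IsGelfandPair ν H)
    (E : Submodule ℂ C(G, ℂ)) [FiniteDimensional ℂ E]
    (hL : ∀ f ∈ E, ∀ g : G, f.comp (ContinuousMap.mulLeft g) ∈ E)
    (hR : ∀ f ∈ E, ∀ h ∈ H, ∀ x, f (x * h) = f x)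
    (hone : (1 : C(G, ℂ)) ∈ E)
    (hanti : ∀ f ∈ E, (∀ x, (f x).im = 0) → ∀ x y, f x = f y) :
    ∀ f ∈ E, ∀ f' ∈ E, auxInt ν (f * f') = auxInt ν f * auxInt ν f' := by
  obtain ⟨n, e, heE, hexp⟩ := aux_onb ν E
  let T : G → C(G, ℂ) → C(G, ℂ) := fun g f => f.comp (ContinuousMap.mulLeft g)
  have hIT : ∀ g f, auxInt ν (T g f) = auxInt ν f := fun g f =>
    integral_mul_left_eq_self (μ := ν) (fun x => f x) g
  let K : G → C(G, ℂ) := fun y => ∑ i, star (e i y) • e i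
  have hKE : ∀ y, K y ∈ E := fun y => E.sum_mem fun i _ => E.smul_mem _ (heE i)
  have hKx : ∀ y x, K y x = ∑ i, star (e i y) * e i x := by
    intro y x; simp [K, ContinuousMap.sum_apply]
  have hherm : ∀ y x, K y x = star (K x y) := by
    intro y x
    rw [hKx, hKx, star_sum]
    refine Finset.sum_congr rfl fun i _ => ?_
    rw [star_mul', star_star, mul_comm]
  have hinv : ∀ g y, T g (K (g * y)) = K y := by
    intro g y
    refine (hexp _ (hL _ (hKE (g * y)) g)).trans ?_
    refine Finset.sum_congr rfl fun j _ => ?_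
    congr 1
    have ha := hL _ (heE j) g⁻¹
    have h1 : T g (K (g * y)) * star (e j) = T g (K (g * y) * star (T g⁻¹ (e j))) := by
      ext x; simp [T]
    have h2 := congrArg (fun f : C(G, ℂ) => star (f (g * y))) (hexp _ ha)
    change auxInt ν (T g (K (g * y)) * star (e j)) = _
    rw [h1, hIT]
    have h3 : star ((T g⁻¹ (e j)) (g * y)) = star (e j y) := by simp [T]
    rw [← h3]
    refine Eq.trans ?_ h2.symm
    simp only [K, Finset.sum_mul, map_sum, smul_mul_assoc, map_smul, ContinuousMap.sum_apply,
      star_sum, ContinuousMap.smul_apply, smul_eq_mul, star_mul']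
    refine Finset.sum_congr rfl fun i _ => ?_
    rw [← auxInt_star, star_mul', star_star, mul_comm]
    congr 2
    exact mul_comm _ _
  have hKφ : ∀ y x, K 1 (y⁻¹ * x) = K y x := by
    intro y x
    have := congrArg (fun f : C(G, ℂ) => f x) (hinv y⁻¹ y)
    simpa [T] using this
  have hKH : ∀ h ∈ H, K h = K 1 := by
    intro h hh
    refine Finset.sum_congr rfl fun i _ => ?_
    have := hR _ (heE i) h hh 1
    rw [one_mul] at this
    rw [this]
  have hbi : ∀ h₁ ∈ H, ∀ h₂ ∈ H, ∀ g : G, K 1 (h₁ * g * h₂) = K 1 g := by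
    intro h₁ hh₁ h₂ hh₂ g
    rw [hR _ (hKE 1) h₂ hh₂]
    have := hKφ h₁⁻¹ g
    rw [inv_inv] at this
    rw [this, hKH _ (H.inv_mem hh₁)]
  have hgel := hG (fun x => K 1 x) (fun x => star (K 1 x)) (K 1).continuous
    (continuous_star.comp (K 1).continuous) hbi
    (fun h₁ hh₁ h₂ hh₂ g => by simp only [hbi h₁ hh₁ h₂ hh₂ g])
  have hreal : ∀ g, auxInt ν (K 1 * K g) = star (auxInt ν (K 1 * K g)) := by
    intro g
    have h := hgel g
    simp only [hKφ] at h
    rw [← auxInt_star]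
    simp only [auxInt_apply]
    refine Eq.trans ?_ (h.trans ?_)
    · refine integral_congr_ae (Filter.Eventually.of_forall fun x => ?_)
      simp only [ContinuousMap.mul_apply]
      rw [← hherm]
    · refine integral_congr_ae (Filter.Eventually.of_forall fun x => ?_)
      simp only [ContinuousMap.star_apply, ContinuousMap.mul_apply, star_mul']
      rw [← hherm x g]
  obtain ⟨c, hc⟩ : ∃ c, ∀ g, auxInt ν (K 1 * K g) = c := by
    let ψ : C(G, ℂ) := ∑ j, star (auxInt ν (K 1 * e j)) • e j
    have hψE : ψ ∈ E := E.sum_mem fun i _ => E.smul_mem _ (heE i)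
    have hψ : ∀ g, ψ g = auxInt ν (K 1 * K g) := by
      intro g
      rw [hreal]
      have : K g = ∑ i, star (e i g) • e i := rfl
      rw [this, Finset.mul_sum, map_sum, star_sum]
      simp only [ψ, ContinuousMap.sum_apply, ContinuousMap.smul_apply, smul_eq_mul,
        mul_smul_comm, map_smul, star_mul', star_star]
      exact Finset.sum_congr rfl fun i _ => mul_comm _ _
    have hcst := hanti ψ hψE (fun x => by
      have := hreal x
      rw [← hψ] at this
      exact Complex.conj_eq_iff_im.1 this.symm)
    exact ⟨ψ 1, fun g => by rw [← hψ, hcst g 1]⟩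
  have hB : ∀ y z, auxInt ν (K y * K z) = c := by
    intro y z
    rw [← hc (y⁻¹ * z), ← hIT y⁻¹ (K 1 * K (y⁻¹ * z))]
    congr 1
    have h1 := hinv y⁻¹ y
    rw [inv_mul_cancel] at h1
    rw [← h1, ← hinv y⁻¹ z]
    rfl
  have hfun : ∀ (L : C(G, ℂ) →ₗ[ℂ] ℂ) (d : ℂ), (∀ z, L (K z) = d) →
      ∀ f ∈ E, L f = auxInt ν f * d := by
    intro L d hLd f hf
    have h1 : ∑ j, L (e j) • star (e j) = d • (1 : C(G, ℂ)) := by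
      ext z
      rw [ContinuousMap.smul_apply, ContinuousMap.one_apply, ← hLd z]
      simp only [K, map_sum, map_smul, ContinuousMap.sum_apply, ContinuousMap.smul_apply,
        smul_eq_mul, mul_one, ContinuousMap.star_apply]
      exact Finset.sum_congr rfl fun i _ => mul_comm _ _
    have h2 : auxInt ν (f * ∑ j, L (e j) • star (e j)) = auxInt ν f * d := by
      rw [h1, mul_smul_comm, mul_one, map_smul, smul_eq_mul, mul_comm]
    rw [← h2, Finset.mul_sum, map_sum]
    conv_lhs => rw [hexp f hf]
    rw [map_sum]
    refine Finset.sum_congr rfl fun i _ => ?_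
    rw [map_smul, mul_smul_comm, map_smul, smul_eq_mul, smul_eq_mul, mul_comm]
  have hall : ∀ f ∈ E, ∀ f' ∈ E, auxInt ν (f * f') = auxInt ν f * (auxInt ν f' * c) := by
    intro f hf f' hf'
    have step : ∀ y, auxInt ν (K y * f') = auxInt ν f' * c := fun y =>
      hfun ((auxInt ν).comp (LinearMap.mulLeft ℂ (K y))) c (fun z => hB y z) f' hf'
    have := hfun ((auxInt ν).comp (LinearMap.mulLeft ℂ f')) (auxInt ν f' * c)
      (fun z => by
        have := step z
        rw [mul_comm] at this
        exact this) f hf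
    rw [mul_comm f f']
    exact this
  have hc1 : c = 1 := by
    have := hall 1 hone 1 hone
    rw [mul_one, auxInt_one] at this
    simpa using this.symm
  intro f hf f' hf'
  rw [hall f hf f' hf', hc1, mul_one]

theorem aux_poly_cont {V : Type*} [NormedAddCommGroup V] [NormedSpace ℂ V]
    [FiniteDimensional ℂ V] {p : V → ℂ} (hp : p ∈ polyAlg V) : Continuous p := by
  unfold polyAlg at hp
  induction hp using Algebra.adjoin_induction with
  | mem x hx =>
    obtain ⟨l, rfl⟩ := hx
    exact l.continuous_of_finiteDimensional
  | algebraMap r => exact continuous_const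
  | add x y _ _ hx hy => exact hx.add hy
  | mul x y _ _ hx hy => exact hx.mul hy

/-- Precomposition as an algebra homomorphism. -/
def auxTr {V : Type*} (φ : V → V) : (V → ℂ) →ₐ[ℂ] (V → ℂ) where
  toFun f := f ∘ φ
  map_one' := rfl
  map_mul' _ _ := rfl
  map_zero' := rfl
  map_add' _ _ := rfl
  commutes' _ := rfl

theorem aux_inv_sub {V : Type*} [NormedAddCommGroup V] [NormedSpace ℂ V]
    [FiniteDimensional ℂ V] {p : V → ℂ} (hp : p ∈ polyAlg V) :
    ∃ E : Submodule ℂ (V → ℂ), E.FG ∧ E ≤ Subalgebra.toSubmodule (polyAlg V) ∧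
      (∀ φ : V →ₗ[ℂ] V, E.map (auxTr φ).toLinearMap ≤ E) ∧ p ∈ E := by
  unfold polyAlg at hp
  induction hp using Algebra.adjoin_induction with
  | mem x hx =>
    obtain ⟨l, rfl⟩ := hx
    refine ⟨LinearMap.range (LinearMap.ltoFun ℂ V ℂ ℂ), ?_, ?_, ?_, ?_⟩
    · rw [LinearMap.range_eq_map]
      exact Submodule.FG.map _ Module.Finite.fg_top
    · rintro _ ⟨l, rfl⟩
      exact Algebra.subset_adjoin ⟨l, rfl⟩
    · rintro φ _ ⟨_, ⟨l, rfl⟩, rfl⟩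
      exact ⟨l.comp φ, rfl⟩
    · exact ⟨l, rfl⟩
  | algebraMap r =>
    refine ⟨1, ⟨{1}, by simp [Submodule.one_eq_span]⟩, ?_, ?_, ?_⟩
    · rw [Submodule.one_le]
      exact one_mem (polyAlg V)
    · intro φ
      rw [Submodule.map_one]
    · exact Submodule.algebraMap_mem r
  | add x y _ _ hx hy =>
    obtain ⟨E, h1, h2, h3, h4⟩ := hx
    obtain ⟨F, k1, k2, k3, k4⟩ := hy
    refine ⟨E ⊔ F, h1.sup k1, sup_le h2 k2, fun φ => ?_, Submodule.add_mem_sup h4 k4⟩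
    rw [Submodule.map_sup]
    exact sup_le_sup (h3 φ) (k3 φ)
  | mul x y _ _ hx hy =>
    obtain ⟨E, h1, h2, h3, h4⟩ := hx
    obtain ⟨F, k1, k2, k3, k4⟩ := hy
    refine ⟨E * F, h1.mul k1, ?_, fun φ => ?_, Submodule.mul_mem_mul h4 k4⟩
    · rw [Submodule.mul_le]
      intro a ha b hb
      exact mul_mem (S := Subalgebra ℂ (V → ℂ)) (h2 ha) (k2 hb)
    · rw [Submodule.map_mul]
      exact mul_le_mul' (h3 φ) (k3 φ)

/-- Separation of variables for `p (A u)`. -/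
theorem aux_sep {V : Type*} [NormedAddCommGroup V] [NormedSpace ℂ V]
    [FiniteDimensional ℂ V] {p : V → ℂ} (hp : p ∈ polyAlg V) :
    ∃ (ι : Type) (_ : Fintype ι) (c : ι → (V →L[ℂ] V) → ℂ) (q : ι → V → ℂ),
      (∀ i, Continuous (c i)) ∧ (∀ i, q i ∈ polyAlg V) ∧
      ∀ (A : V →L[ℂ] V) (u : V), p (A u) = ∑ i, c i A * q i u := by
  unfold polyAlg at hp
  induction hp using Algebra.adjoin_induction with
  | mem x hx =>
    obtain ⟨l, rfl⟩ := hx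
    let b := Module.finBasis ℂ V
    refine ⟨Fin (Module.finrank ℂ V), inferInstance, fun i A => l (A (b i)),
      fun i => ⇑(b.coord i), fun i => ?_, fun i => ?_, fun A u => ?_⟩
    · exact l.continuous_of_finiteDimensional.comp
        (ContinuousLinearMap.apply ℂ V (b i)).continuous
    · exact Algebra.subset_adjoin ⟨_, rfl⟩
    · conv_lhs => rw [← b.sum_repr u]
      simp only [map_sum, map_smul, smul_eq_mul, Module.Basis.coord_apply]
      exact Finset.sum_congr rfl fun i _ => mul_comm _ _
  | algebraMap r =>
    refine ⟨Unit, inferInstance, fun _ _ => r, fun _ => 1, fun _ => continuous_const,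
      fun _ => one_mem _, fun A u => ?_⟩
    simp
  | add x y _ _ hx hy =>
    obtain ⟨ι, _, c, q, h1, h2, h3⟩ := hx
    obtain ⟨κ, _, d, r, k1, k2, k3⟩ := hy
    refine ⟨ι ⊕ κ, inferInstance, Sum.elim c d, Sum.elim q r, ?_, ?_, fun A u => ?_⟩
    · rintro (i | i)
      exacts [h1 i, k1 i]
    · rintro (i | i)
      exacts [h2 i, k2 i]
    · simp [Fintype.sum_sum_type, h3, k3]
  | mul x y _ _ hx hy =>
    obtain ⟨ι, _, c, q, h1, h2, h3⟩ := hx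
    obtain ⟨κ, _, d, r, k1, k2, k3⟩ := hy
    refine ⟨ι × κ, inferInstance, fun i A => c i.1 A * d i.2 A, fun i => q i.1 * r i.2,
      fun i => (h1 _).mul (k1 _), fun i => mul_mem (h2 _) (k2 _), fun A u => ?_⟩
    rw [Pi.mul_apply, h3, k3, Finset.sum_mul_sum, Fintype.sum_prod_type]
    refine Finset.sum_congr rfl fun i _ => Finset.sum_congr rfl fun j _ => ?_
    simp only [Pi.mul_apply]
    ring

theorem aux_act_cont {V : Type*} [NormedAddCommGroup V] [NormedSpace ℂ V]
    (G : Subgroup (V →L[ℂ] V)ˣ) (u : V) : Continuous fun g : G => g • u :=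
  (ContinuousLinearMap.apply ℂ V u).continuous.comp
    (Units.continuous_val.comp continuous_subtype_val)

/-- If `v` is in the nilpotent cone, Haar averages over the orbit evaluate polynomials at `0`. -/
theorem aux_mean {V : Type*} [NormedAddCommGroup V] [NormedSpace ℂ V] [FiniteDimensional ℂ V]
    (G : Subgroup (V →L[ℂ] V)ˣ) [CompactSpace G]
    (v : V) [MeasurableSpace G] [BorelSpace G]
    (ν : Measure G) [ν.IsHaarMeasure] [IsProbabilityMeasure ν]
    (hv : ∀ p ∈ polyAlg V, (∀ (g : G) (u : V), p (g • u) = p u) → p 0 = 0 → p v = 0)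
    {p : V → ℂ} (hp : p ∈ polyAlg V) : ∫ g : G, p (g⁻¹ • v) ∂ν = p 0 := by
  let P : V → ℂ := fun u => ∫ g : G, p (g⁻¹ • u) ∂ν
  have hP : P ∈ polyAlg V := by
    obtain ⟨ι, _, c, q, h1, h2, h3⟩ := aux_sep hp
    have : P = ∑ i, (∫ g : G, c i ((g⁻¹ : G) : (V →L[ℂ] V)ˣ) ∂ν) • q i := by
      funext u
      have e1 : ∀ g : G, p (g⁻¹ • u) = ∑ i, c i ((g⁻¹ : G) : (V →L[ℂ] V)ˣ) * q i u :=
        fun g => h3 _ u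
      simp only [P, e1]
      rw [integral_finsetSum]
      · simp [integral_mul_const]
      · intro i _
        refine aux_integrable ν _ (Continuous.mul ?_ continuous_const)
        exact (h1 i).comp (Units.continuous_val.comp (continuous_subtype_val.comp continuous_inv))
    rw [this]
    exact sum_mem fun i _ => Subalgebra.smul_mem _ (h2 i) _
  have hPinv : ∀ (h : G) (u : V), P (h • u) = P u := by
    intro h u
    have := integral_mul_left_eq_self (μ := ν) (fun g : G => p (g⁻¹ • u)) h⁻¹
    simp only [mul_inv_rev, inv_inv, mul_smul] at this
    exact this
  have hP0 : P 0 = p 0 := by simp [P]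
  have h := hv (P - algebraMap ℂ (V → ℂ) (p 0)) (sub_mem hP (Subalgebra.algebraMap_mem _ _))
    (fun g u => by simp [hPinv]) (by simp [hP0])
  simpa [sub_eq_zero] using h

end OrbitHelpers

/-- Let `G` be a compact connected subgroup of `GL(V)` with no nonzero fixed vectors
in `V`, and let `M = G·v` be a commutative orbit.  Then `P(M)` is antisymmetric iff
`v` lies in the nilpotent cone `N` (the common zero set of the `G`-invariant
polynomials vanishing at `0`); in that case the polynomially convex hull of `M` is
contained in `N`. -/
theorem orbit_polyAlgebra_antisymmetric_iff_nilpotent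
    {V : Type*} [NormedAddCommGroup V] [NormedSpace ℂ V] [FiniteDimensional ℂ V]
    (G : Subgroup (V →L[ℂ] V)ˣ)
    (hGcpt : IsCompact (G : Set (V →L[ℂ] V)ˣ))
    (hGconn : IsConnected (G : Set (V →L[ℂ] V)ˣ))
    (hfix : ∀ w : V, (∀ g : G, g • w = w) → w = 0)
    (v : V)
    [MeasurableSpace G] [BorelSpace G]
    (ν : Measure G) [ν.IsHaarMeasure] [IsProbabilityMeasure ν]
    (hGelfand : IsGelfandPair ν (stabilizer G v)) :
    ((∀ f ∈ closure (polyRestrict V (orbit G v)),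
        (∀ x : orbit G v, (f x).im = 0) → ∀ x y : orbit G v, f x = f y) ↔
      v ∈ {w : V | ∀ p ∈ polyAlg V,
        (∀ (g : G) (u : V), p (g • u) = p u) → p 0 = 0 → p w = 0}) ∧
    (v ∈ {w : V | ∀ p ∈ polyAlg V,
        (∀ (g : G) (u : V), p (g • u) = p u) → p 0 = 0 → p w = 0} →
      polyHull (orbit G v) ⊆ {w : V | ∀ p ∈ polyAlg V,
        (∀ (g : G) (u : V), p (g • u) = p u) → p 0 = 0 → p w = 0}) := by
  have hcs : CompactSpace G := isCompact_iff_compactSpace.1 hGcpt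
  refine ⟨⟨fun hanti => ?_, fun hv => ?_⟩, fun hv w hw p hp hinv hp0 => ?_⟩
  · -- antisymmetric implies nilpotent
    let S : polyAlg V → C(G, ℂ) := fun p =>
      ⟨fun g => p.1 (g • v), (aux_poly_cont p.2).comp (aux_act_cont G v)⟩
    have hmul : ∀ p q : polyAlg V, auxInt ν (S p * S q) = auxInt ν (S p) * auxInt ν (S q) := by
      intro p q
      obtain ⟨E₁, a1, a2, a3, a4⟩ := aux_inv_sub p.2
      obtain ⟨E₂, b1, b2, b3, b4⟩ := aux_inv_sub q.2
      obtain ⟨E₃, c1, c2, c3, c4⟩ := aux_inv_sub (one_mem (polyAlg V))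
      let F : Submodule ℂ (V → ℂ) := E₁ ⊔ E₂ ⊔ E₃
      have hFfg : F.FG := (a1.sup b1).sup c1
      have hFle : F ≤ Subalgebra.toSubmodule (polyAlg V) := sup_le (sup_le a2 b2) c2
      have hFinv : ∀ φ : V →ₗ[ℂ] V, F.map (auxTr φ).toLinearMap ≤ F := by
        intro φ
        rw [Submodule.map_sup, Submodule.map_sup]
        exact sup_le_sup (sup_le_sup (a3 φ) (b3 φ)) (c3 φ)
      let D : Submodule ℂ (G → ℂ) := F.map (LinearMap.funLeft ℂ ℂ fun g : G => g • v)
      have hDfg : D.FG := hFfg.map _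
      have hDfin : FiniteDimensional ℂ D := Module.Finite.iff_fg.2 hDfg
      let E : Submodule ℂ C(G, ℂ) := D.comap (ContinuousMap.coeFnLinearMap ℂ)
      have hEfin : FiniteDimensional ℂ E := by
        refine Module.Finite.of_injective
          ((ContinuousMap.coeFnLinearMap ℂ).restrict (p := E) (q := D) fun f hf => hf) ?_
        intro f g hfg
        exact Subtype.ext (DFunLike.coe_injective (congrArg Subtype.val hfg))
      have hES : ∀ r : polyAlg V, r.1 ∈ F → S r ∈ E := fun r hr => ⟨r.1, hr, rfl⟩
      have hSE : ∀ f ∈ E, ∃ r ∈ F, ∀ g : G, f g = r (g • v) := by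
        rintro f ⟨r, hr, hrf⟩
        exact ⟨r, hr, fun g => (congrFun hrf g).symm⟩
      refine aux_core ν (stabilizer G v) hGelfand E ?_ ?_ ?_ ?_ _ (hES p ?_) _ (hES q ?_)
      · intro f hf g
        obtain ⟨r, hr, hrf⟩ := hSE f hf
        refine ⟨r ∘ fun u => g • u, hFinv (((g : (V →L[ℂ] V)ˣ) : V →L[ℂ] V) : V →ₗ[ℂ] V)
          (Submodule.mem_map_of_mem hr), ?_⟩
        funext x
        have := hrf (g * x)
        rw [mul_smul] at this
        exact this.symm
      · intro f hf h hh x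
        obtain ⟨r, hr, hrf⟩ := hSE f hf
        rw [hrf, hrf, mul_smul, mem_stabilizer_iff.1 hh]
      · exact hES 1 (Submodule.mem_sup_right c4)
      · intro f hf him x y
        obtain ⟨r, hr, hrf⟩ := hSE f hf
        let r' : C(orbit G v, ℂ) :=
          ⟨fun z => r z, (aux_poly_cont (hFle hr)).comp continuous_subtype_val⟩
        have := hanti r' (subset_closure ⟨r, hFle hr, fun _ => rfl⟩)
          (by
            rintro ⟨_, g, rfl⟩
            have := him g
            rw [hrf] at this
            exact this) ⟨x • v, x, rfl⟩ ⟨y • v, y, rfl⟩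
        rw [hrf, hrf]
        exact this
      · exact Submodule.mem_sup_left (Submodule.mem_sup_left a4)
      · exact Submodule.mem_sup_left (Submodule.mem_sup_right b4)
    have hmean : ∀ (p : V → ℂ) (hp : p ∈ polyAlg V), auxInt ν (S ⟨p, hp⟩) = p 0 := by
      intro p hp
      induction hp using Algebra.adjoin_induction with
      | mem x hx =>
        obtain ⟨l, rfl⟩ := hx
        have hfd : CompleteSpace V := FiniteDimensional.complete ℂ V
        letI : NormedSpace ℝ V := NormedSpace.restrictScalars ℝ ℂ V
        have hi : Integrable (fun g : G => g • v) ν := aux_integrable ν _ (aux_act_cont G v)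
        have hz : ∫ g : G, g • v ∂ν = 0 := by
          apply hfix
          intro h
          have h1 := ContinuousLinearMap.integral_comp_comm
            ((h : (V →L[ℂ] V)ˣ) : V →L[ℂ] V) hi
          have h2 := integral_mul_left_eq_self (μ := ν) (fun g : G => g • v) h
          simp only [mul_smul] at h2
          exact h1.symm.trans h2
        have h3 := ContinuousLinearMap.integral_comp_comm (LinearMap.toContinuousLinearMap l) hi
        rw [hz] at h3
        rw [auxInt_apply, map_zero]
        rw [map_zero] at h3
        exact h3
      | algebraMap r =>
        rw [auxInt_apply]
        simp [S]
      | add x y hx hy ihx ihy =>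
        have : S ⟨x + y, add_mem hx hy⟩ = S ⟨x, hx⟩ + S ⟨y, hy⟩ := rfl
        rw [this, map_add, ihx, ihy]
        rfl
      | mul x y hx hy ihx ihy =>
        have : S ⟨x * y, mul_mem hx hy⟩ = S ⟨x, hx⟩ * S ⟨y, hy⟩ := rfl
        rw [this, hmul, ihx, ihy]
        rfl
    intro p hp hinv hp0
    have h := hmean p hp
    rw [auxInt_apply, hp0] at h
    simpa [S, hinv] using h
  · -- nilpotent implies antisymmetric
    intro f hf him
    let o : C(G, orbit G v) := ⟨fun g => ⟨g⁻¹ • v, g⁻¹, rfl⟩,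
      ((aux_act_cont G v).comp continuous_inv).subtype_mk _⟩
    have hI : ∀ f ∈ closure (polyRestrict V (orbit G v)),
        auxInt ν (f.comp o * f.comp o) = auxInt ν (f.comp o) * auxInt ν (f.comp o) := by
      have hc1 : Continuous fun f : C(orbit G v, ℂ) => f.comp o :=
        ContinuousMap.continuous_precomp o
      have hcl : IsClosed {f : C(orbit G v, ℂ) |
          auxInt ν (f.comp o * f.comp o) = auxInt ν (f.comp o) * auxInt ν (f.comp o)} :=
        isClosed_eq ((auxInt_continuous ν).comp (hc1.mul hc1))
          (((auxInt_continuous ν).comp hc1).mul ((auxInt_continuous ν).comp hc1))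
      refine fun f hf => closure_minimal ?_ hcl hf
      rintro f ⟨p, hp, hpf⟩
      have h1 := aux_mean G v ν hv hp
      have h2 := aux_mean G v ν hv (mul_mem hp hp)
      have e1 : auxInt ν (f.comp o) = p 0 := by
        rw [← h1, auxInt_apply]
        exact integral_congr_ae (Filter.Eventually.of_forall fun g => hpf _)
      have e2 : auxInt ν (f.comp o * f.comp o) = p 0 * p 0 := by
        refine Eq.trans ?_ h2
        rw [auxInt_apply]
        refine integral_congr_ae (Filter.Eventually.of_forall fun g => ?_)
        simp only [ContinuousMap.mul_apply, ContinuousMap.comp_apply, hpf]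
        rfl
      change auxInt ν (f.comp o * f.comp o) = auxInt ν (f.comp o) * auxInt ν (f.comp o)
      rw [e1, e2]
    have hIf := hI f hf
    let φ : G → ℝ := fun g => (f (o g)).re
    have hφc : Continuous φ := Complex.continuous_re.comp (f.comp o).continuous
    have hfφ : ∀ g, f (o g) = (φ g : ℂ) := fun g =>
      Complex.ext (by simp [φ]) (by simp [him])
    let c : ℝ := ∫ g, φ g ∂ν
    have h1 : auxInt ν (f.comp o) = (c : ℂ) := by
      rw [auxInt_apply]
      simp only [ContinuousMap.comp_apply, hfφ, c]
      exact integral_ofReal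
    have h2 : ∫ g, φ g * φ g ∂ν = c * c := by
      rw [h1, auxInt_apply] at hIf
      simp only [ContinuousMap.mul_apply, ContinuousMap.comp_apply, hfφ, ← Complex.ofReal_mul] at hIf
      exact Complex.ofReal_injective (integral_ofReal.symm.trans hIf)
    have h3 : ∫ g, (φ g - c) ^ 2 ∂ν = 0 := by
      have e : ∀ g, (φ g - c) ^ 2 = φ g * φ g - (2 * c) * φ g + c ^ 2 := fun g => by ring
      simp only [e]
      rw [integral_add, integral_sub, h2, integral_const_mul]
      · simp only [integral_const, probReal_univ, smul_eq_mul]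
        change c * c - 2 * c * c + 1 * c ^ 2 = 0
        ring
      all_goals exact aux_integrable ν _ (by fun_prop)
    have hsq : Continuous fun g => (φ g - c) ^ 2 := (hφc.sub continuous_const).pow 2
    have h4 := (integral_eq_zero_iff_of_nonneg (fun g => sq_nonneg _)
      (aux_integrable ν _ hsq)).1 h3
    have h5 := (Continuous.ae_eq_iff_eq ν hsq continuous_const).1 h4
    have h6 : ∀ g, f (o g) = (c : ℂ) := by
      intro g
      have := congrFun h5 g
      rw [hfφ, sub_eq_zero.1 (pow_eq_zero_iff (two_ne_zero)|>.1 this)]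
    have h7 : ∀ x : orbit G v, f x = (c : ℂ) := by
      rintro ⟨_, g, rfl⟩
      have := h6 g⁻¹
      rw [← this]
      exact congrArg f (Subtype.ext (by simp [o]))
    intro x y
    rw [h7, h7]
  · -- the hull
    have hpv := hv p hp hinv hp0
    have h := hw p hp
    have hz : ∀ z : orbit G v, ‖p (z : V)‖ = 0 := by
      rintro ⟨_, g, rfl⟩
      simp [hinv, hpv]
    simp only [hz, Real.iSup_const_zero] at h
    exact norm_le_zero_iff.1 h
end

section
/- Let V be a finite-dimensional complex vector space, G a compact connected subgroup of GL(V), v ∈ V, and M = G·v. Assume (G, Stab_G(v)) is a Gelfand pair, where Stab_G(v) = {g ∈ G : g v = v}. Then the polynomially convex hull M̂ of M contains exactly one polynomially convex G-orbit: there exists w ∈ M̂ such that the orbit G·w ⊆ M̂ is polynomially convex, and for any w₁, w₂ ∈ M̂ whose orbits G·w₁ and G·w₂ are both polynomially convex, G·w₁ = G·w₂. -/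
open MeasureTheory MulAction

section Core

open scoped ComplexConjugate InnerProductSpace

set_option linter.unusedSectionVars false

/-- The hull, in a purely algebraic setting. -/
def pHull {V : Type*} [AddCommGroup V] [Module ℂ V] (K : Set V) : Set V :=
  {w | ∀ p ∈ polyAlg V, ‖p w‖ ≤ ⨆ z : K, ‖p (z : V)‖}

section algebraic

variable {V : Type*} [AddCommGroup V] [Module ℂ V]

lemma linear_mem_polyAlg (l : V →ₗ[ℂ] ℂ) : (⇑l : V → ℂ) ∈ polyAlg V :=
  Algebra.subset_adjoin ⟨l, rfl⟩

lemma const_mem_polyAlg (c : ℂ) : (fun _ : V => c) ∈ polyAlg V :=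
  (polyAlg V).algebraMap_mem c

lemma polyAlg_induction {P : (V → ℂ) → Prop} (hl : ∀ l : V →ₗ[ℂ] ℂ, P (⇑l))
    (hc : ∀ c : ℂ, P (fun _ => c)) (ha : ∀ p q, P p → P q → P (fun z => p z + q z))
    (hm : ∀ p q, P p → P q → P (fun z => p z * q z)) {p : V → ℂ} (hp : p ∈ polyAlg V) : P p := by
  unfold polyAlg at hp
  induction hp using Algebra.adjoin_induction with
  | mem x hx => obtain ⟨l, rfl⟩ := hx; exact hl l
  | algebraMap r => exact hc r
  | add x y _ _ h1 h2 => exact ha _ _ h1 h2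
  | mul x y _ _ h1 h2 => exact hm _ _ h1 h2

lemma polyAlg_comp (T : V →ₗ[ℂ] V) {p : V → ℂ} (hp : p ∈ polyAlg V) :
    (fun z => p (T z)) ∈ polyAlg V := by
  exact polyAlg_induction (P := fun p => (fun z => p (T z)) ∈ polyAlg V)
    (fun l => linear_mem_polyAlg (l.comp T)) (fun c => const_mem_polyAlg c)
    (fun p q h1 h2 => (polyAlg V).add_mem h1 h2) (fun p q h1 h2 => (polyAlg V).mul_mem h1 h2) hp

lemma polyAlg_sum {ι : Type*} (s : Finset ι) (c : ι → ℂ) (p : ι → V → ℂ)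
    (hp : ∀ i, p i ∈ polyAlg V) : (fun z => ∑ i ∈ s, c i * p i z) ∈ polyAlg V := by
  have : (fun z => ∑ i ∈ s, c i * p i z) = ∑ i ∈ s, c i • p i := by
    ext z; simp
  rw [this]
  exact (polyAlg V).sum_mem fun i _ => (polyAlg V).smul_mem (hp i) _

end algebraic

variable {V : Type*} [NormedAddCommGroup V] [InnerProductSpace ℂ V] [FiniteDimensional ℂ V]

lemma polyAlg_continuous {p : V → ℂ} (hp : p ∈ polyAlg V) : Continuous p := by
  exact polyAlg_induction (P := fun p => Continuous p)
    (fun l => l.continuous_of_finiteDimensional) (fun c => continuous_const)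
    (fun p q h1 h2 => h1.add h2) (fun p q h1 h2 => h1.mul h2) hp

lemma inner_mem_polyAlg (u : V) : (fun z => ⟪u, z⟫_ℂ) ∈ polyAlg V :=
  linear_mem_polyAlg (innerSL ℂ u).toLinearMap

set_option maxHeartbeats 1000000 in
/-- Bezout-type statement on a polynomially convex compact set. -/
lemma bezout {ι : Type*} [Fintype ι] {K : Set V} (hK : IsCompact K) (hne : K.Nonempty)
    (hull : pHull K ⊆ K)
    (f : ι → V → ℂ) (hf : ∀ i, f i ∈ polyAlg V) (hz : ∀ z ∈ K, ∃ i, f i z ≠ 0) :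
    ∃ h : ι → V → ℂ, (∀ i, h i ∈ polyAlg V) ∧ ∀ z ∈ K, ‖∑ i, h i z * f i z - 1‖ < 1 / 2 := by
  classical
  have : CompactSpace K := isCompact_iff_compactSpace.mp hK
  have : Nonempty K := hne.to_subtype
  let R : polyAlg V →ₐ[ℂ] C(K, ℂ) :=
    { toFun := fun p => ⟨fun x => p.1 x, (polyAlg_continuous p.2).comp continuous_subtype_val⟩
      map_one' := rfl
      map_mul' := fun _ _ => rfl
      map_zero' := rfl
      map_add' := fun _ _ => rfl
      commutes' := fun _ => rfl }
  let A : Subalgebra ℂ C(K, ℂ) := R.range.topologicalClosure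
  have hAc : IsClosed (A : Set C(K, ℂ)) := R.range.isClosed_topologicalClosure
  have : CompleteSpace A := hAc.completeSpace_coe
  have hone : NormOneClass A := ⟨by
    change ‖(1 : C(K, ℂ))‖ = 1
    exact norm_one⟩
  have hRA : ∀ p, R p ∈ A := fun p => R.range.le_topologicalClosure ⟨p, rfl⟩
  let r : polyAlg V →ₐ[ℂ] A := R.codRestrict A hRA
  let F : ι → A := fun i => r ⟨f i, hf i⟩
  by_cases hI : Ideal.span (Set.range F) = ⊤
  · have h1 : (1 : A) ∈ Ideal.span (Set.range F) := by rw [hI]; trivial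
    obtain ⟨a, ha⟩ := (Ideal.mem_span_range_iff_exists_fun).1 h1
    -- approximate
    have hcont : Continuous fun b : ι → C(K, ℂ) => ∑ i, b i * (F i : C(K, ℂ)) := by fun_prop
    have hd : (fun i => (a i : C(K, ℂ))) ∈
        closure (Set.pi Set.univ fun _ : ι => (R.range : Set C(K, ℂ))) := by
      rw [closure_pi_set]
      intro i _
      exact (a i).2
    have hopen : IsOpen {b : ι → C(K, ℂ) | ‖∑ i, b i * (F i : C(K, ℂ)) - 1‖ < 1 / 2} :=
      isOpen_lt (by fun_prop) continuous_const
    have hmem : (fun i => (a i : C(K, ℂ))) ∈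
        {b : ι → C(K, ℂ) | ‖∑ i, b i * (F i : C(K, ℂ)) - 1‖ < 1 / 2} := by
      have : ∑ i, (a i : C(K, ℂ)) * (F i : C(K, ℂ)) = 1 := by
        have := congrArg (fun x : A => (x : C(K, ℂ))) ha
        simpa using this
      simp [this]
    obtain ⟨b, hb1, hb2⟩ := mem_closure_iff.1 hd _ hopen hmem
    have : ∀ i, ∃ p : polyAlg V, R p = b i := fun i => hb2 i trivial
    choose p hp using this
    refine ⟨fun i => (p i).1, fun i => (p i).2, fun z hz => ?_⟩
    refine lt_of_le_of_lt ?_ hb1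
    have := ContinuousMap.norm_coe_le_norm (∑ i, b i * (F i : C(K, ℂ)) - 1) ⟨z, hz⟩
    refine le_trans (le_of_eq ?_) this
    simp only [ContinuousMap.sub_apply, ContinuousMap.sum_apply, ContinuousMap.mul_apply, ← hp]
    rfl
  · exfalso
    obtain ⟨J, hJ, hIJ⟩ := Ideal.exists_le_maximal _ hI
    let φ := J.toCharacterSpace
    let ψ : A →ₐ[ℂ] ℂ := WeakDual.CharacterSpace.toAlgHom φ
    have hψ : ∀ i, ψ (F i) = 0 := fun i =>
      Ideal.toCharacterSpace_apply_eq_zero_of_mem J (hIJ (Ideal.subset_span ⟨i, rfl⟩))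
    let L : Module.Dual ℂ V →ₗ[ℂ] ℂ :=
      { toFun := fun l => ψ (r ⟨⇑l, linear_mem_polyAlg l⟩)
        map_add' := fun l m => by
          rw [← map_add, ← map_add]; rfl
        map_smul' := fun c l => by
          simp only [RingHom.id_apply]
          rw [← map_smul, ← map_smul]; rfl }
    let w : V := (Module.evalEquiv ℂ V).symm L
    have hw : ∀ l : V →ₗ[ℂ] ℂ, ψ (r ⟨⇑l, linear_mem_polyAlg l⟩) = l w := fun l =>
      (Module.apply_evalEquiv_symm_apply ℂ V l L).symm
    have key : ∀ p : V → ℂ, p ∈ polyAlg V → ∃ hp : p ∈ polyAlg V, ψ (r ⟨p, hp⟩) = p w := by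
      intro p hp
      refine polyAlg_induction (P := fun p => ∃ hp : p ∈ polyAlg V, ψ (r ⟨p, hp⟩) = p w)
        ?_ ?_ ?_ ?_ hp
      · intro l; exact ⟨_, hw l⟩
      · intro c
        refine ⟨const_mem_polyAlg c, ?_⟩
        have : (⟨fun _ => c, const_mem_polyAlg c⟩ : polyAlg V) = algebraMap ℂ _ c := rfl
        rw [this, AlgHom.commutes, AlgHom.commutes]; rfl
      · intro p q h1 h2
        obtain ⟨hp, h1⟩ := h1
        obtain ⟨hq, h2⟩ := h2
        refine ⟨(polyAlg V).add_mem hp hq, ?_⟩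
        change _ = p w + q w
        rw [← h1, ← h2, ← map_add, ← map_add]; rfl
      · intro p q h1 h2
        obtain ⟨hp, h1⟩ := h1
        obtain ⟨hq, h2⟩ := h2
        refine ⟨(polyAlg V).mul_mem hp hq, ?_⟩
        change _ = p w * q w
        rw [← h1, ← h2, ← map_mul, ← map_mul]; rfl
    have hwK : w ∈ K := by
      apply hull
      intro p hp
      obtain ⟨hp', h⟩ := key p hp
      rw [← h]
      refine (AlgHom.norm_apply_le_self ψ _).trans ?_
      change ‖R ⟨p, hp'⟩‖ ≤ _
      rw [ContinuousMap.norm_eq_iSup_norm]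
      exact le_rfl
    obtain ⟨i, hi⟩ := hz w hwK
    obtain ⟨_, h⟩ := key (f i) (hf i)
    exact hi (h ▸ hψ i)

section Group

variable {G : Type*} [Group G] [TopologicalSpace G] [IsTopologicalGroup G] [CompactSpace G]
  [MeasurableSpace G] [BorelSpace G] [DistribMulAction G V] [SMulCommClass G ℂ V]

lemma orbit_compact (hc : ∀ x : V, Continuous fun g : G => g • x) (v : V) :
    IsCompact (orbit G v) := isCompact_range (hc v)

lemma mem_pHull_orbit (hc : ∀ x : V, Continuous fun g : G => g • x) (v w : V) :
    w ∈ pHull (orbit G v) ↔ ∀ p ∈ polyAlg V, ∃ g : G, ‖p w‖ ≤ ‖p (g • v)‖ := by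
  constructor
  · intro hw p hp
    obtain ⟨g, -, hg⟩ := isCompact_univ.exists_isMaxOn (s := (Set.univ : Set G)) ⟨1, trivial⟩
      (f := fun g => ‖p (g • v)‖) ((polyAlg_continuous hp).comp (hc v)).norm.continuousOn
    refine ⟨g, (hw p hp).trans ?_⟩
    have : Nonempty (orbit G v) := ⟨⟨v, mem_orbit_self v⟩⟩
    refine ciSup_le ?_
    rintro ⟨_, k, rfl⟩
    exact hg (Set.mem_univ k)
  · intro h p hp
    obtain ⟨g, hg⟩ := h p hp
    refine hg.trans ?_
    have hb : BddAbove (Set.range fun z : orbit G v => ‖p (z : V)‖) := by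
      have := (orbit_compact hc v).bddAbove_image
        (f := fun z => ‖p z‖) (polyAlg_continuous hp).norm.continuousOn
      rwa [Set.image_eq_range] at this
    exact le_ciSup hb ⟨g • v, mem_orbit v g⟩

lemma pHull_smul (hc : ∀ x : V, Continuous fun g : G => g • x) {v w : V}
    (hw : w ∈ pHull (orbit G v)) (g : G) : g • w ∈ pHull (orbit G v) := by
  rw [mem_pHull_orbit hc] at hw ⊢
  intro p hp
  obtain ⟨k, hk⟩ := hw _ (polyAlg_comp (DistribSMul.toLinearMap ℂ V g) hp)
  refine ⟨g * k, ?_⟩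
  simpa [mul_smul] using hk

lemma pHull_trans (hc : ∀ x : V, Continuous fun g : G => g • x) {v w z : V}
    (hw : w ∈ pHull (orbit G v)) (hz : z ∈ pHull (orbit G w)) : z ∈ pHull (orbit G v) := by
  rw [mem_pHull_orbit hc] at hz ⊢
  intro p hp
  obtain ⟨k, hk⟩ := hz p hp
  obtain ⟨l, hl⟩ := (mem_pHull_orbit hc _ _).1 (pHull_smul hc hw k) p hp
  exact ⟨l, hk.trans hl⟩

lemma self_mem_pHull (hc : ∀ x : V, Continuous fun g : G => g • x) (v : V) :
    v ∈ pHull (orbit G v) := by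
  rw [mem_pHull_orbit hc]
  intro p hp
  exact ⟨1, by simp⟩

lemma norm_smul_of_unitary (hu : ∀ (g : G) (x y : V), ⟪g • x, g • y⟫_ℂ = ⟪x, y⟫_ℂ) (g : G)
    (x : V) : ‖g • x‖ = ‖x‖ := by
  rw [norm_eq_sqrt_re_inner (𝕜 := ℂ), norm_eq_sqrt_re_inner (𝕜 := ℂ), hu]

lemma inner_smul_left_inv (hu : ∀ (g : G) (x y : V), ⟪g • x, g • y⟫_ℂ = ⟪x, y⟫_ℂ) (g : G)
    (x y : V) : ⟪g • x, y⟫_ℂ = ⟪x, g⁻¹ • y⟫_ℂ := by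
  rw [← hu g x, smul_inv_smul]

lemma inner_smul_right_inv (hu : ∀ (g : G) (x y : V), ⟪g • x, g • y⟫_ℂ = ⟪x, y⟫_ℂ) (g : G)
    (x y : V) : ⟪x, g • y⟫_ℂ = ⟪g⁻¹ • x, y⟫_ℂ := by
  rw [← hu g (g⁻¹ • x), smul_inv_smul]

/-- Points of the hull have norm at most that of the orbit. -/
lemma norm_le_of_mem_pHull (hc : ∀ x : V, Continuous fun g : G => g • x)
    (hu : ∀ (g : G) (x y : V), ⟪g • x, g • y⟫_ℂ = ⟪x, y⟫_ℂ) {v w : V}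
    (hw : w ∈ pHull (orbit G v)) : ‖w‖ ≤ ‖v‖ := by
  obtain ⟨g, hg⟩ := (mem_pHull_orbit hc _ _).1 hw _ (inner_mem_polyAlg w)
  have h1 : ‖⟪w, g • v⟫_ℂ‖ ≤ ‖w‖ * ‖v‖ := by
    rw [← norm_smul_of_unitary hu g v]; exact norm_inner_le_norm _ _
  have h2 : ‖⟪w, w⟫_ℂ‖ = ‖w‖ * ‖w‖ := by
    rw [inner_self_eq_norm_sq_to_K]; simp [sq]
  by_contra! h
  have : 0 < ‖w‖ := lt_of_le_of_lt (norm_nonneg v) h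
  nlinarith

/-- Existence part. -/
lemma exists_convex_orbit (hc : ∀ x : V, Continuous fun g : G => g • x)
    (hu : ∀ (g : G) (x y : V), ⟪g • x, g • y⟫_ℂ = ⟪x, y⟫_ℂ) (v : V) :
    ∃ w ∈ pHull (orbit G v), orbit G w ⊆ pHull (orbit G v) ∧
      pHull (orbit G w) = orbit G w := by
  have hclosed : IsClosed (pHull (orbit G v)) := by
    have : pHull (orbit G v) = ⋂ p ∈ polyAlg V, {w | ‖p w‖ ≤ ⨆ z : orbit G v, ‖p (z : V)‖} := by
      ext; simp [pHull]
    rw [this]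
    exact isClosed_biInter fun p hp =>
      isClosed_le (polyAlg_continuous hp).norm continuous_const
  have hcomp : IsCompact (pHull (orbit G v)) := by
    have := FiniteDimensional.proper ℂ V
    refine Metric.isCompact_of_isClosed_isBounded hclosed ?_
    refine (Metric.isBounded_closedBall (x := (0 : V)) (r := ‖v‖)).subset fun w hw => ?_
    simpa using norm_le_of_mem_pHull hc hu hw
  obtain ⟨w, hw, hmin⟩ := hcomp.exists_isMinOn ⟨v, self_mem_pHull hc v⟩
    (f := fun z => ‖z‖) continuous_norm.continuousOn
  refine ⟨w, hw, ?_, ?_⟩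
  · rintro _ ⟨g, rfl⟩
    exact pHull_smul hc hw g
  apply Set.Subset.antisymm
  · intro z hz
    have hn : ‖z‖ = ‖w‖ :=
      le_antisymm (norm_le_of_mem_pHull hc hu hz) (hmin (pHull_trans hc hw hz))
    have hp : (fun x => ⟪z, x⟫_ℂ + (‖z‖ ^ 2 : ℝ)) ∈ polyAlg V :=
      (polyAlg V).add_mem (inner_mem_polyAlg z) (const_mem_polyAlg _)
    obtain ⟨g, hg⟩ := (mem_pHull_orbit hc _ _).1 hz _ hp
    have hgn : ‖g • w‖ = ‖z‖ := by rw [norm_smul_of_unitary hu, hn]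
    have h1 : ‖⟪z, g • w⟫_ℂ‖ ≤ ‖z‖ ^ 2 := by
      refine (norm_inner_le_norm _ _).trans ?_
      rw [hgn, sq]
    have h2 : ⟪z, z⟫_ℂ = ((‖z‖ ^ 2 : ℝ) : ℂ) := by
      rw [inner_self_eq_norm_sq_to_K]; simp
    have h3 : 2 * ‖z‖ ^ 2 ≤ ‖⟪z, g • w⟫_ℂ + (‖z‖ ^ 2 : ℝ)‖ := by
      refine le_trans (le_of_eq ?_) hg
      rw [h2, ← Complex.ofReal_add, Complex.norm_real, Real.norm_of_nonneg (by positivity)]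
      ring
    have hre : (⟪z, g • w⟫_ℂ).re = ‖z‖ ^ 2 := by
      generalize ⟪z, g • w⟫_ℂ = c at *
      set r := ‖z‖ ^ 2
      have hr : 0 ≤ r := by positivity
      have e1 : ‖c‖ ^ 2 ≤ r ^ 2 := by gcongr
      have e2 : (2 * r) ^ 2 ≤ ‖c + (r : ℂ)‖ ^ 2 := by gcongr
      rw [Complex.sq_norm, Complex.normSq_apply] at e1 e2
      simp only [Complex.add_re, Complex.add_im, Complex.ofReal_re, Complex.ofReal_im] at e2
      rcases hr.eq_or_lt with h0 | h0
      · rw [← h0] at e1 ⊢; nlinarith [mul_self_nonneg c.im, mul_self_nonneg c.re]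
      · have e3 : r ≤ c.re := by nlinarith
        nlinarith [mul_self_nonneg c.im]
    have hsub : ‖z - g • w‖ ^ 2 = 0 := by
      rw [norm_sub_sq (𝕜 := ℂ), hgn]
      have : RCLike.re ⟪z, g • w⟫_ℂ = ‖z‖ ^ 2 := hre
      rw [this]; ring
    have : z = g • w := by
      rw [← sub_eq_zero, ← norm_eq_zero]; exact pow_eq_zero_iff two_ne_zero |>.1 hsub
    exact ⟨g, this.symm⟩
  · rintro _ ⟨g, rfl⟩
    exact pHull_smul hc (self_mem_pHull hc w) g

lemma real_on_hull (hc : ∀ x : V, Continuous fun g : G => g • x) {v w : V}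
    (hw : w ∈ pHull (orbit G v)) {u : V → ℂ} (hu : u ∈ polyAlg V)
    (hr : ∀ g : G, (u (g • v)).im = 0) : (u w).im = 0 := by
  obtain ⟨g₀, -, hg₀⟩ := isCompact_univ.exists_isMaxOn (s := (Set.univ : Set G)) ⟨1, trivial⟩
      (f := fun g => ‖u (g • v)‖) ((polyAlg_continuous hu).comp (hc v)).norm.continuousOn
  set C := ‖u (g₀ • v)‖
  have key : ∀ N : ℝ, (u w).re ^ 2 + (u w).im ^ 2 + 2 * (u w).im * N ≤ C ^ 2 := by
    intro N
    obtain ⟨g, hg⟩ := (mem_pHull_orbit hc _ _).1 hw (fun z => u z + (N : ℂ) * Complex.I)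
      ((polyAlg V).add_mem hu (const_mem_polyAlg _))
    have h1 : ‖u (g • v)‖ ≤ C := hg₀ (Set.mem_univ g)
    have h2 : ‖u (g • v)‖ ^ 2 ≤ C ^ 2 := by gcongr
    have h3 : ‖u w + (N : ℂ) * Complex.I‖ ^ 2 ≤ ‖u (g • v) + (N : ℂ) * Complex.I‖ ^ 2 := by
      gcongr
    rw [Complex.sq_norm, Complex.normSq_apply] at h2
    rw [Complex.sq_norm, Complex.normSq_apply, Complex.sq_norm, Complex.normSq_apply] at h3
    have h4 := hr g
    simp [h4] at h2 h3
    nlinarith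
  by_contra h
  have := key ((C ^ 2 + 1) / (2 * (u w).im))
  have e : 2 * (u w).im * ((C ^ 2 + 1) / (2 * (u w).im)) = C ^ 2 + 1 := by field_simp
  rw [e] at this
  nlinarith [sq_nonneg (u w).re, sq_nonneg (u w).im]

lemma conj_on_hull (hc : ∀ x : V, Continuous fun g : G => g • x) {v w : V}
    (hw : w ∈ pHull (orbit G v)) {p q : V → ℂ} (hp : p ∈ polyAlg V) (hq : q ∈ polyAlg V)
    (h : ∀ g : G, q (g • v) = conj (p (g • v))) : q w = conj (p w) := by
  have h1 := real_on_hull hc hw ((polyAlg V).add_mem hp hq) (fun g => by simp [h])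
  have h2 := real_on_hull hc hw ((polyAlg V).smul_mem ((polyAlg V).sub_mem hq hp) Complex.I)
    (fun g => by simp [h])
  simp at h1 h2
  apply Complex.ext
  · simp; linarith
  · simp; linarith

lemma invariant_on_hull (hc : ∀ x : V, Continuous fun g : G => g • x) {v w : V}
    (hw : w ∈ pHull (orbit G v)) {p : V → ℂ} (hp : p ∈ polyAlg V)
    (h : ∀ (g : G), p (g • v) = p v) : p w = p v := by
  obtain ⟨g, hg⟩ := (mem_pHull_orbit hc _ _).1 hw (fun z => p z - p v)
    ((polyAlg V).sub_mem hp (const_mem_polyAlg _))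
  rw [h, sub_self, norm_zero] at hg
  exact sub_eq_zero.1 (norm_le_zero_iff.1 hg)

lemma integrable_cont {F : Type*} [NormedAddCommGroup F]
    (ν : Measure G) [ν.IsHaarMeasure] {f : G → F} (hf : Continuous f) : Integrable f ν :=
  hf.integrable_of_hasCompactSupport (HasCompactSupport.of_compactSpace f)

lemma smul_expand (hc : ∀ x : V, Continuous fun g : G => g • x) {p : V → ℂ}
    (hp : p ∈ polyAlg V) : ∃ (ι : Type) (_ : Fintype ι) (c : ι → G → ℂ) (q : ι → V → ℂ),
      (∀ i, Continuous (c i)) ∧ (∀ i, q i ∈ polyAlg V) ∧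
      ∀ (g : G) (z : V), p (g • z) = ∑ i, c i g * q i z := by
  refine polyAlg_induction (P := fun p => ∃ (ι : Type) (_ : Fintype ι) (c : ι → G → ℂ)
      (q : ι → V → ℂ), (∀ i, Continuous (c i)) ∧ (∀ i, q i ∈ polyAlg V) ∧
      ∀ (g : G) (z : V), p (g • z) = ∑ i, c i g * q i z) ?_ ?_ ?_ ?_ hp
  · intro l
    let b := Module.finBasis ℂ V
    refine ⟨_, inferInstance, fun i g => l (g • b i), fun i => ⇑(b.coord i), ?_, ?_, ?_⟩
    · intro i
      exact l.continuous_of_finiteDimensional.comp (hc _)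
    · intro i; exact linear_mem_polyAlg _
    · intro g z
      conv_lhs => rw [← b.sum_repr z]
      rw [Finset.smul_sum, map_sum]
      refine Finset.sum_congr rfl fun i _ => ?_
      rw [smul_comm g, map_smul, smul_eq_mul, mul_comm]; rfl
  · intro c
    refine ⟨Unit, inferInstance, fun _ _ => c, fun _ _ => 1, fun _ => continuous_const,
      fun _ => const_mem_polyAlg 1, by simp⟩
  · rintro p q ⟨ι, _, c, a, h1, h2, h3⟩ ⟨κ, _, d, b, h4, h5, h6⟩
    refine ⟨ι ⊕ κ, inferInstance, Sum.elim c d, Sum.elim a b, ?_, ?_, ?_⟩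
    · rintro (i | i) <;> simp [h1, h4]
    · rintro (i | i) <;> simp [h2, h5]
    · intro g z; simp [h3, h6]
  · rintro p q ⟨ι, _, c, a, h1, h2, h3⟩ ⟨κ, _, d, b, h4, h5, h6⟩
    refine ⟨ι × κ, inferInstance, fun i g => c i.1 g * d i.2 g, fun i z => a i.1 z * b i.2 z,
      ?_, ?_, ?_⟩
    · intro i; exact (h1 _).mul (h4 _)
    · intro i; exact (polyAlg V).mul_mem (h2 _) (h5 _)
    · intro g z
      simp only [h3, h6, Finset.sum_mul_sum, Fintype.sum_prod_type]
      refine Finset.sum_congr rfl fun i _ => Finset.sum_congr rfl fun j _ => ?_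
      ring

lemma avg_mem (ν : Measure G) [ν.IsHaarMeasure]
    (hc : ∀ x : V, Continuous fun g : G => g • x) {p : V → ℂ} (hp : p ∈ polyAlg V)
    {k : G → ℂ} (hk : Continuous k) : (fun z => ∫ g, p (g • z) * k g ∂ν) ∈ polyAlg V := by
  obtain ⟨ι, _, c, q, h1, h2, h3⟩ := smul_expand hc hp
  have : (fun z => ∫ g, p (g • z) * k g ∂ν) =
      fun z => ∑ i, (∫ g, c i g * k g ∂ν) * q i z := by
    ext z
    simp only [h3, Finset.sum_mul]
    rw [integral_finsetSum]
    · refine Finset.sum_congr rfl fun i _ => ?_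
      rw [← integral_mul_const]
      congr 1; ext g; ring
    · intro i _
      refine integrable_cont ν ?_
      exact ((h1 i).mul continuous_const).mul hk
  rw [this]
  exact polyAlg_sum _ _ _ h2

/-- Schur's lemma. -/
lemma schur {E : Submodule ℂ V}
    (hirr : ∀ F : Submodule ℂ V, F ≤ E → (∀ (g : G), ∀ x ∈ F, g • x ∈ F) → F = ⊥ ∨ F = E)
    (hE : ∀ (g : G), ∀ x ∈ E, g • x ∈ E)
    (T : V →ₗ[ℂ] V) (hTE : ∀ x ∈ E, T x ∈ E) (hTG : ∀ (g : G) x, T (g • x) = g • T x) :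
    ∃ α : ℂ, ∀ x ∈ E, T x = α • x := by
  by_cases hbot : E = ⊥
  · exact ⟨0, fun x hx => by rw [hbot, Submodule.mem_bot] at hx; simp [hx]⟩
  have : Nontrivial E := Submodule.nontrivial_iff_ne_bot.2 hbot
  obtain ⟨α, hα⟩ := Module.End.exists_eigenvalue (T.restrict hTE)
  obtain ⟨x, hx⟩ := hα.exists_hasEigenvector
  refine ⟨α, ?_⟩
  let F : Submodule ℂ V := E ⊓ LinearMap.ker (T - α • LinearMap.id)
  have hmem : ∀ y, y ∈ F ↔ y ∈ E ∧ T y = α • y := by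
    intro y; simp [F, sub_eq_zero]
  have hF : ∀ (g : G), ∀ y ∈ F, g • y ∈ F := by
    intro g y hy
    rw [hmem] at hy ⊢
    exact ⟨hE g y hy.1, by rw [hTG, hy.2, smul_comm]⟩
  have hxF : (x : V) ∈ F := by
    rw [hmem]
    refine ⟨x.2, ?_⟩
    have := congrArg (fun y : E => (y : V)) hx.apply_eq_smul
    simpa using this
  rcases hirr F inf_le_left hF with h | h
  · exfalso
    rw [h, Submodule.mem_bot] at hxF
    exact hx.2 (by ext; simpa using hxF)
  · intro y hy
    rw [← h] at hy
    exact ((hmem y).1 hy).2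

/-- The averaged rank-one operator. -/
noncomputable def avgOp (ν : Measure G) [ν.IsHaarMeasure]
    (hc : ∀ x : V, Continuous fun g : G => g • x) (a b : V) : V →ₗ[ℂ] V where
  toFun x := ∫ k : G, ⟪k • b, x⟫_ℂ • (k • a) ∂ν
  map_add' x y := by
    rw [← integral_add]
    · simp only [inner_add_right, add_smul]
    · exact integrable_cont ν (((hc b).inner continuous_const).smul (hc a))
    · exact integrable_cont ν (((hc b).inner continuous_const).smul (hc a))
  map_smul' c x := by
    rw [RingHom.id_apply, ← integral_smul]
    simp only [inner_smul_right, mul_smul]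

lemma inner_avgOp (ν : Measure G) [ν.IsHaarMeasure]
    (hc : ∀ x : V, Continuous fun g : G => g • x) (a b x y : V) :
    ⟪y, avgOp ν hc a b x⟫_ℂ = ∫ k : G, ⟪y, k • a⟫_ℂ * ⟪k • b, x⟫_ℂ ∂ν := by
  have hIntg : Integrable (fun k : G => ⟪k • b, x⟫_ℂ • (k • a)) ν :=
    integrable_cont ν (((hc b).inner continuous_const).smul (hc a))
  have := FiniteDimensional.complete ℂ V
  change ⟪y, ∫ k : G, ⟪k • b, x⟫_ℂ • (k • a) ∂ν⟫_ℂ = _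
  rw [← integral_inner hIntg]
  simp only [inner_smul_right, mul_comm]

lemma avgOp_scalar (ν : Measure G) [ν.IsHaarMeasure]
    (hc : ∀ x : V, Continuous fun g : G => g • x)
    (hu : ∀ (g : G) (x y : V), ⟪g • x, g • y⟫_ℂ = ⟪x, y⟫_ℂ) {E : Submodule ℂ V}
    (hirr : ∀ F : Submodule ℂ V, F ≤ E → (∀ (g : G), ∀ x ∈ F, g • x ∈ F) → F = ⊥ ∨ F = E)
    (hE : ∀ (g : G), ∀ x ∈ E, g • x ∈ E) {a b : V} (ha : a ∈ E) :
    ∃ α : ℂ, ∀ x ∈ E, avgOp ν hc a b x = α • x := by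
  refine schur hirr hE (avgOp ν hc a b) ?_ ?_
  · intro x _
    rw [← Submodule.orthogonal_orthogonal E, Submodule.mem_orthogonal]
    intro y hy
    rw [inner_avgOp]
    have : ∀ k : G, ⟪y, k • a⟫_ℂ = 0 := fun k =>
      (Submodule.mem_orthogonal' E y).1 hy _ (hE k a ha)
    simp [this]
  · intro g x
    refine ext_inner_left ℂ fun y => ?_
    rw [inner_smul_right_inv hu, inner_avgOp, inner_avgOp,
      ← integral_mul_left_eq_self _ g]
    congr 1; ext k
    rw [mul_smul, mul_smul, hu, inner_smul_right_inv hu]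

/-- In an irreducible representation, the vectors fixed by `H` form an at most
one-dimensional space if `(G, H)` is a Gelfand pair. -/
lemma gelfand_fixed (ν : Measure G) [ν.IsHaarMeasure]
    (hc : ∀ x : V, Continuous fun g : G => g • x)
    (hu : ∀ (g : G) (x y : V), ⟪g • x, g • y⟫_ℂ = ⟪x, y⟫_ℂ) {E : Submodule ℂ V}
    (hirr : ∀ F : Submodule ℂ V, F ≤ E → (∀ (g : G), ∀ x ∈ F, g • x ∈ F) → F = ⊥ ∨ F = E)
    (hE : ∀ (g : G), ∀ x ∈ E, g • x ∈ E) {H : Subgroup G} (hH : IsGelfandPair ν H)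
    {a b : V} (ha : a ∈ E) (hb : b ∈ E) (haH : ∀ h ∈ H, h • a = a) (hbH : ∀ h ∈ H, h • b = b)
    (hab : ⟪b, a⟫_ℂ = 0) (ha0 : a ≠ 0) : b = 0 := by
  obtain ⟨α, hα⟩ := avgOp_scalar ν hc hu hirr hE (a := a) (b := a) ha
  obtain ⟨β, hβ⟩ := avgOp_scalar ν hc hu hirr hE (a := a) (b := b) ha
  have hinv : ∀ c : V, (∀ h ∈ H, h • c = c) → ∀ h₁ ∈ H, ∀ h₂ ∈ H, ∀ g : G,
      ⟪c, (h₁ * g * h₂) • a⟫_ℂ = ⟪c, g • a⟫_ℂ := by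
    intro c hcH h₁ hh₁ h₂ hh₂ g
    rw [mul_smul, haH _ hh₂, mul_smul, inner_smul_right_inv hu, hcH _ (H.inv_mem hh₁)]
  have hG := hH (fun k => ⟪b, k • a⟫_ℂ) (fun k => ⟪a, k • a⟫_ℂ)
    (continuous_const.inner (hc a)) (continuous_const.inner (hc a)) (hinv b hbH) (hinv a haH)
  have key : ∀ g : G, α * ⟪b, g • a⟫_ℂ = β * ⟪a, g • a⟫_ℂ := by
    intro g
    have e1 : ∫ k, ⟪b, k • a⟫_ℂ * ⟪a, (k⁻¹ * g) • a⟫_ℂ ∂ν = α * ⟪b, g • a⟫_ℂ := by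
      rw [← inner_smul_right, ← hα _ (hE g a ha), inner_avgOp]
      congr 1; ext k
      rw [mul_smul, ← inner_smul_left_inv hu]
    have e2 : ∫ k, ⟪a, k • a⟫_ℂ * ⟪b, (k⁻¹ * g) • a⟫_ℂ ∂ν = β * ⟪a, g • a⟫_ℂ := by
      rw [← inner_smul_right, ← hβ _ (hE g a ha), inner_avgOp]
      congr 1; ext k
      rw [mul_smul, ← inner_smul_left_inv hu]
    rw [← e1, ← e2]
    exact hG g
  have hβ0 : β = 0 := by
    have := key 1
    rw [one_smul, hab, mul_zero] at this
    rcases mul_eq_zero.1 this.symm with h | h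
    · exact h
    · exact absurd (inner_self_eq_zero.1 h) ha0
  have hα0 : α ≠ 0 := by
    intro h0
    have h1 : ⟪a, avgOp ν hc a a a⟫_ℂ = 0 := by rw [hα a ha, h0]; simp
    rw [inner_avgOp] at h1
    have h2 : ∀ k : G, ⟪a, k • a⟫_ℂ * ⟪k • a, a⟫_ℂ = ((‖⟪a, k • a⟫_ℂ‖ ^ 2 : ℝ) : ℂ) := by
      intro k
      rw [← inner_conj_symm (k • a) a, Complex.mul_conj, Complex.normSq_eq_norm_sq]
    simp only [h2] at h1
    rw [integral_complex_ofReal, Complex.ofReal_eq_zero] at h1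
    have hcont : Continuous fun k : G => ‖⟪a, k • a⟫_ℂ‖ ^ 2 :=
      (continuous_const.inner (hc a)).norm.pow 2
    have := hcont.integral_pos_of_hasCompactSupport_nonneg_nonzero (μ := ν)
      (HasCompactSupport.of_compactSpace _) (fun k => by positivity) (x := 1)
      (by simpa using ha0)
    exact this.ne' h1
  have hba : ∀ g : G, ⟪b, g • a⟫_ℂ = 0 := by
    intro g
    have := key g
    rw [hβ0, zero_mul] at this
    exact (mul_eq_zero.1 this).resolve_left hα0
  -- the span of the orbit of `a` is `E`
  let F : Submodule ℂ V := Submodule.span ℂ (orbit G a)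
  have hFE : F ≤ E := by
    refine Submodule.span_le.2 ?_
    rintro _ ⟨g, rfl⟩
    exact hE g a ha
  have hFG : ∀ (g : G), ∀ x ∈ F, g • x ∈ F := by
    intro g x hx
    induction hx using Submodule.span_induction with
    | mem x hx =>
      obtain ⟨k, rfl⟩ := hx
      exact Submodule.subset_span ⟨g * k, mul_smul g k a⟩
    | zero => simp
    | add x y _ _ h1 h2 => rw [smul_add]; exact F.add_mem h1 h2
    | smul c x _ h => rw [smul_comm]; exact F.smul_mem _ h
  have haF : a ∈ F := Submodule.subset_span (mem_orbit_self a)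
  have hFeq : F = E := (hirr F hFE hFG).resolve_left fun h => by
    rw [h, Submodule.mem_bot] at haF; exact ha0 haF
  have hall : ∀ x ∈ F, ⟪b, x⟫_ℂ = 0 := by
    intro x hx
    induction hx using Submodule.span_induction with
    | mem x hx => obtain ⟨k, rfl⟩ := hx; exact hba k
    | zero => simp
    | add x y _ _ h1 h2 => rw [inner_add_right, h1, h2, add_zero]
    | smul c x _ h => rw [inner_smul_right, h, mul_zero]
  exact inner_self_eq_zero.1 (hall b (hFeq ▸ hb))

/-- Key lemma: conjugates of the coordinates in an irreducible component which does not vanish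
on some polynomially convex orbit in the hull are polynomial on the orbit. -/
lemma conj_poly_of_irr (ν : Measure G) [ν.IsHaarMeasure] [IsProbabilityMeasure ν]
    [ν.IsMulRightInvariant]
    (hc : ∀ x : V, Continuous fun g : G => g • x)
    (hu : ∀ (g : G) (x y : V), ⟪g • x, g • y⟫_ℂ = ⟪x, y⟫_ℂ) {E : Submodule ℂ V}
    (hirr : ∀ F : Submodule ℂ V, F ≤ E → (∀ (g : G), ∀ x ∈ F, g • x ∈ F) → F = ⊥ ∨ F = E)
    (hE : ∀ (g : G), ∀ x ∈ E, g • x ∈ E) {v w : V} (hH : IsGelfandPair ν (stabilizer G v))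
    (hw : w ∈ pHull (orbit G v)) (hconv : pHull (orbit G w) = orbit G w)
    {u₀ : V} (hu₀ : u₀ ∈ E) (hne : ⟪u₀, w⟫_ℂ ≠ 0) {u : V} (hu' : u ∈ E) :
    ∃ q ∈ polyAlg V, ∀ g : G, q (g • v) = conj ⟪u, g • v⟫_ℂ := by
  let b := stdOrthonormalBasis ℂ E
  have hspan : ∀ z : V, (∀ i, ⟪(b i : V), z⟫_ℂ = 0) → ∀ x ∈ E, ⟪x, z⟫_ℂ = 0 := by
    intro z hz x hx
    have : x = ∑ i, b.repr ⟨x, hx⟩ i • (b i : V) := by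
      have := congrArg (fun y : E => (y : V)) (b.sum_repr ⟨x, hx⟩)
      simpa using this.symm
    rw [this, sum_inner]
    exact Finset.sum_eq_zero fun i _ => by rw [inner_smul_left, hz, mul_zero]
  obtain ⟨h, hpoly, hh⟩ := bezout (orbit_compact hc w) ⟨w, mem_orbit_self w⟩ hconv.le
    (fun i z => ⟪(b i : V), z⟫_ℂ) (fun i => inner_mem_polyAlg _) (by
      rintro _ ⟨g, rfl⟩
      by_contra! hcon
      refine hne ?_
      rw [← hu g]
      exact hspan _ hcon _ (hE g _ hu₀))
  have hIntg : ∀ z x : V, ∀ i, Integrable (fun g : G => h i (g • z) * ⟪(b i : V), g • x⟫_ℂ) ν :=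
    fun z x i => integrable_cont ν
      (((polyAlg_continuous (hpoly i)).comp (hc z)).mul (continuous_const.inner (hc x)))
  let Φ : V → V → ℂ := fun z x => ∑ i, ∫ g : G, h i (g • z) * ⟪(b i : V), g • x⟫_ℂ ∂ν
  have hΦpoly : ∀ x, (fun z => Φ z x) ∈ polyAlg V := by
    intro x
    have := polyAlg_sum Finset.univ (fun _ => 1)
      (fun i z => ∫ g : G, h i (g • z) * ⟪(b i : V), g • x⟫_ℂ ∂ν)
      (fun i => avg_mem ν hc (hpoly i) (continuous_const.inner (hc x)))
    simpa [Φ] using this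
  have hΦinv : ∀ (g : G) z x, Φ (g • z) (g • x) = Φ z x := by
    intro g z x
    refine Finset.sum_congr rfl fun i _ => ?_
    rw [← integral_mul_right_eq_self (fun k : G => h i (k • z) * ⟪(b i : V), k • x⟫_ℂ) g]
    simp only [mul_smul]
  -- diagonal
  have hdiag : ∀ z, Φ z z = ∫ g : G, (∑ i, h i (g • z) * ⟪(b i : V), g • z⟫_ℂ) * 1 ∂ν := by
    intro z
    simp only [mul_one]
    rw [integral_finsetSum _ fun i _ => hIntg z z i]
  have hdpoly : (fun z => Φ z z) ∈ polyAlg V := by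
    have h1 : (fun z => ∑ i, 1 * (h i z * ⟪(b i : V), z⟫_ℂ)) ∈ polyAlg V :=
      polyAlg_sum Finset.univ (fun _ => 1) (fun i z => h i z * ⟪(b i : V), z⟫_ℂ)
        fun i => (polyAlg V).mul_mem (hpoly i) (inner_mem_polyAlg _)
    simp only [one_mul] at h1
    simp only [hdiag]
    exact avg_mem ν hc h1 (k := fun _ => 1) continuous_const
  have hdw : Φ w w = Φ v v := invariant_on_hull hc hw hdpoly fun g => hΦinv g v v
  have hdne : Φ v v ≠ 0 := by
    rw [← hdw]
    intro h0
    rw [hdiag] at h0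
    simp only [mul_one] at h0
    have hi : Integrable (fun g : G => ∑ i, h i (g • w) * ⟪(b i : V), g • w⟫_ℂ) ν :=
      integrable_finsetSum _ fun i _ => hIntg w w i
    have h1 : ∫ g : G, ((∑ i, h i (g • w) * ⟪(b i : V), g • w⟫_ℂ) - 1) ∂ν = -1 := by
      rw [integral_sub hi (integrable_const _), h0]; simp
    have h2 : ‖∫ g : G, ((∑ i, h i (g • w) * ⟪(b i : V), g • w⟫_ℂ) - 1) ∂ν‖ ≤ 1 / 2 := by
      refine (norm_integral_le_of_norm_le_const (C := 1 / 2) (Filter.Eventually.of_forall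
        fun g => (hh _ ⟨g, rfl⟩).le)).trans ?_
      simp
    rw [h1] at h2
    norm_num at h2
  -- Riesz
  let L : V →ₗ[ℂ] ℂ :=
    { toFun := Φ v
      map_add' := fun x y => by
        simp only [Φ]
        rw [← Finset.sum_add_distrib]
        refine Finset.sum_congr rfl fun i _ => ?_
        rw [← integral_add (hIntg v x i) (hIntg v y i)]
        simp only [smul_add, inner_add_right, mul_add]
      map_smul' := fun c x => by
        simp only [Φ, RingHom.id_apply, smul_eq_mul]
        rw [Finset.mul_sum]
        refine Finset.sum_congr rfl fun i _ => ?_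
        rw [← integral_const_mul]
        congr 1; ext g
        rw [smul_comm g c, inner_smul_right]; ring }
  have := FiniteDimensional.complete ℂ V
  let a : V := (InnerProductSpace.toDual ℂ V).symm (LinearMap.toContinuousLinearMap L)
  have ha : ∀ x, ⟪a, x⟫_ℂ = Φ v x := fun x => by
    simp only [a, InnerProductSpace.toDual_symm_apply]; rfl
  have haE : a ∈ E := by
    rw [← Submodule.orthogonal_orthogonal E, Submodule.mem_orthogonal']
    intro y hy
    rw [ha]
    refine Finset.sum_eq_zero fun i _ => ?_
    have : ∀ g : G, ⟪(b i : V), g • y⟫_ℂ = 0 := fun g => by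
      rw [inner_smul_right_inv hu]
      exact (Submodule.mem_orthogonal E y).1 hy _ (hE _ _ (b i).2)
    simp [this]
  have haH : ∀ k ∈ stabilizer G v, k • a = a := by
    intro k hk
    refine ext_inner_right ℂ fun x => ?_
    rw [inner_smul_left_inv hu, ha, ha, ← hΦinv k, smul_inv_smul, mem_stabilizer_iff.1 hk]
  let e : V := E.starProjection v
  have heE : e ∈ E := Submodule.starProjection_apply_mem E v
  have he : ∀ y ∈ E, ⟪y, e⟫_ℂ = ⟪y, v⟫_ℂ := by
    intro y hy
    have : ⟪y, v - e⟫_ℂ = 0 :=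
      (Submodule.mem_orthogonal E _).1 (Submodule.sub_starProjection_mem_orthogonal v) y hy
    rw [inner_sub_right, sub_eq_zero] at this
    exact this.symm
  have heH : ∀ k ∈ stabilizer G v, k • e = e := by
    intro k hk
    have hd : k • e - e ∈ E := E.sub_mem (hE _ _ heE) heE
    have : ⟪k • e - e, k • e - e⟫_ℂ = 0 := by
      rw [inner_sub_right, inner_smul_right_inv hu, he _ (hE _ _ hd), he _ hd,
        ← inner_smul_right_inv hu, mem_stabilizer_iff.1 hk, sub_self]
    exact sub_eq_zero.1 (inner_self_eq_zero.1 this)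
  have hae : ⟪a, e⟫_ℂ ≠ 0 := by rw [he a haE, ha]; exact hdne
  have he0 : e ≠ 0 := fun h0 => hae (by rw [h0, inner_zero_right])
  have hee : ⟪e, e⟫_ℂ ≠ 0 := fun h0 => he0 (inner_self_eq_zero.1 h0)
  let t : ℂ := ⟪e, a⟫_ℂ / ⟪e, e⟫_ℂ
  have hat : a - t • e = 0 := by
    refine gelfand_fixed ν hc hu hirr hE hH heE (E.sub_mem haE (E.smul_mem t heE)) heH ?_ ?_ he0
    · intro k hk
      rw [smul_sub, smul_comm, haH k hk, heH k hk]
    · rw [← inner_conj_symm, inner_sub_right, inner_smul_right]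
      simp only [t]
      rw [div_mul_cancel₀ _ hee, sub_self, map_zero]
  have hat' : a = t • e := sub_eq_zero.1 hat
  have ht : conj t ≠ 0 := by
    intro h0
    have : t = 0 := by simpa using h0
    rw [hat', this, zero_smul, inner_zero_left] at hae
    exact hae rfl
  refine ⟨fun z => (conj t)⁻¹ * Φ z u, (polyAlg V).smul_mem (hΦpoly u) (conj t)⁻¹, fun g => ?_⟩
  change (conj t)⁻¹ * Φ (g • v) u = _
  have h1 : Φ (g • v) u = conj t * conj ⟪u, g • v⟫_ℂ := by
    rw [← hΦinv g⁻¹, inv_smul_smul, ← ha, hat', inner_smul_left, inner_smul_right_inv hu g u v,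
      ← he _ (hE _ _ hu'), inner_conj_symm]
  rw [h1, inv_mul_cancel_left₀ ht]

/-- A minimal nonzero invariant subspace. -/
lemma exists_irr (W : Submodule ℂ V) (hW : ∀ (g : G), ∀ x ∈ W, g • x ∈ W) (hne : W ≠ ⊥) :
    ∃ E : Submodule ℂ V, E ≤ W ∧ E ≠ ⊥ ∧ (∀ (g : G), ∀ x ∈ E, g • x ∈ E) ∧
      ∀ F : Submodule ℂ V, F ≤ E → (∀ (g : G), ∀ x ∈ F, g • x ∈ F) → F = ⊥ ∨ F = E := by
  obtain ⟨E, ⟨h1, h2, h3⟩, hmin⟩ := (wellFounded_lt (α := Submodule ℂ V)).has_min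
    {E : Submodule ℂ V | E ≤ W ∧ E ≠ ⊥ ∧ ∀ (g : G), ∀ x ∈ E, g • x ∈ E} ⟨W, le_rfl, hne, hW⟩
  refine ⟨E, h1, h2, h3, fun F hF hFG => ?_⟩
  by_contra! hcon
  exact hmin F ⟨hF.trans h1, hcon.1, hFG⟩ (lt_of_le_of_ne hF hcon.2)

lemma unique_convex_orbit (ν : Measure G) [ν.IsHaarMeasure] [IsProbabilityMeasure ν]
    [ν.IsMulRightInvariant]
    (hc : ∀ x : V, Continuous fun g : G => g • x)
    (hu : ∀ (g : G) (x y : V), ⟪g • x, g • y⟫_ℂ = ⟪x, y⟫_ℂ)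
    {v w₁ w₂ : V} (hH : IsGelfandPair ν (stabilizer G v))
    (hw₁ : w₁ ∈ pHull (orbit G v)) (hw₂ : w₂ ∈ pHull (orbit G v))
    (hc₁ : pHull (orbit G w₁) = orbit G w₁) (hc₂ : pHull (orbit G w₂) = orbit G w₂) :
    orbit G w₁ = orbit G w₂ := by
  let K : Set V := orbit G w₁ ∪ orbit G w₂
  have hKG : ∀ (g : G), ∀ z ∈ K, g • z ∈ K := by
    rintro g z (hz | hz)
    · obtain ⟨k, rfl⟩ := hz
      exact Or.inl ⟨g * k, mul_smul g k w₁⟩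
    · obtain ⟨k, rfl⟩ := hz
      exact Or.inr ⟨g * k, mul_smul g k w₂⟩
  have hKhull : ∀ z ∈ K, z ∈ pHull (orbit G v) := by
    rintro z (⟨g, rfl⟩ | ⟨g, rfl⟩)
    · exact pHull_smul hc hw₁ g
    · exact pHull_smul hc hw₂ g
  let D : Submodule ℂ V :=
    { carrier := {u | ∃ q ∈ polyAlg V, ∀ z ∈ K, q z = ⟪z, u⟫_ℂ}
      add_mem' := by
        rintro a b ⟨q, hq, h⟩ ⟨r, hr, h'⟩
        refine ⟨q + r, (polyAlg V).add_mem hq hr, fun z hz => ?_⟩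
        rw [Pi.add_apply, h z hz, h' z hz, inner_add_right]
      zero_mem' := ⟨0, (polyAlg V).zero_mem, fun z _ => by simp⟩
      smul_mem' := by
        rintro c a ⟨q, hq, h⟩
        refine ⟨c • q, (polyAlg V).smul_mem hq c, fun z hz => ?_⟩
        rw [Pi.smul_apply, h z hz, inner_smul_right, smul_eq_mul] }
  have hDG : ∀ (g : G), ∀ x ∈ D, g • x ∈ D := by
    rintro g x ⟨q, hq, h⟩
    refine ⟨_, polyAlg_comp (DistribSMul.toLinearMap ℂ V g⁻¹) hq, fun z hz => ?_⟩
    rw [inner_smul_right_inv hu, ← h _ (hKG g⁻¹ z hz)]; rfl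
  have hDtop : D = ⊤ := by
    by_contra hD
    have hperp : Dᗮ ≠ ⊥ := fun h => hD (Submodule.orthogonal_eq_bot_iff.1 h)
    have hperpG : ∀ (g : G), ∀ x ∈ Dᗮ, g • x ∈ Dᗮ := by
      intro g x hx
      rw [Submodule.mem_orthogonal] at hx ⊢
      intro y hy
      rw [inner_smul_right_inv hu]
      exact hx _ (hDG _ _ hy)
    obtain ⟨E, hEW, hE0, hE, hirr⟩ := exists_irr Dᗮ hperpG hperp
    have hED : E ≤ D := by
      intro u huE
      by_cases hne : (∃ u₀ ∈ E, ⟪u₀, w₁⟫_ℂ ≠ 0) ∨ (∃ u₀ ∈ E, ⟪u₀, w₂⟫_ℂ ≠ 0)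
      · have : ∃ q ∈ polyAlg V, ∀ g : G, q (g • v) = conj ⟪u, g • v⟫_ℂ := by
          rcases hne with ⟨u₀, h1, h2⟩ | ⟨u₀, h1, h2⟩
          · exact conj_poly_of_irr ν hc hu hirr hE hH hw₁ hc₁ h1 h2 huE
          · exact conj_poly_of_irr ν hc hu hirr hE hH hw₂ hc₂ h1 h2 huE
        obtain ⟨q, hq, h⟩ := this
        refine ⟨q, hq, fun z hz => ?_⟩
        rw [conj_on_hull hc (hKhull z hz) (inner_mem_polyAlg u) hq h, inner_conj_symm]
      · push Not at hne
        refine ⟨0, (polyAlg V).zero_mem, fun z hz => ?_⟩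
        rcases hz with ⟨g, rfl⟩ | ⟨g, rfl⟩
        · change 0 = ⟪g • w₁, u⟫_ℂ
          rw [inner_smul_left_inv hu, ← inner_conj_symm, hne.1 _ (hE _ _ huE), map_zero]
        · change 0 = ⟪g • w₂, u⟫_ℂ
          rw [inner_smul_left_inv hu, ← inner_conj_symm, hne.2 _ (hE _ _ huE), map_zero]
    apply hE0
    rw [eq_bot_iff]
    have := le_inf hED hEW
    rwa [Submodule.inf_orthogonal_eq_bot] at this
  have hconj : ∀ p ∈ polyAlg V, ∃ q ∈ polyAlg V, ∀ z ∈ K, q z = conj (p z) := by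
    intro p hp
    refine polyAlg_induction (P := fun p => ∃ q ∈ polyAlg V, ∀ z ∈ K, q z = conj (p z))
      ?_ ?_ ?_ ?_ hp
    · intro l
      have := FiniteDimensional.complete ℂ V
      let u : V := (InnerProductSpace.toDual ℂ V).symm (LinearMap.toContinuousLinearMap l)
      have hul : ∀ x, ⟪u, x⟫_ℂ = l x := fun x => by
        simp only [u, InnerProductSpace.toDual_symm_apply]; rfl
      have huD : u ∈ D := by rw [hDtop]; trivial
      obtain ⟨q, hq, h⟩ := huD
      exact ⟨q, hq, fun z hz => by rw [h z hz, ← hul, inner_conj_symm]⟩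
    · intro c
      exact ⟨_, const_mem_polyAlg (conj c), fun _ _ => rfl⟩
    · rintro p q ⟨p', h1, h2⟩ ⟨q', h3, h4⟩
      exact ⟨p' + q', (polyAlg V).add_mem h1 h3, fun z hz => by simp [h2 z hz, h4 z hz]⟩
    · rintro p q ⟨p', h1, h2⟩ ⟨q', h3, h4⟩
      exact ⟨p' * q', (polyAlg V).mul_mem h1 h3, fun z hz => by simp [h2 z hz, h4 z hz]⟩
  -- Stone–Weierstrass
  by_contra hne
  have hdisj : ∀ z, z ∈ orbit G w₁ → z ∉ orbit G w₂ := by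
    intro z h1 h2
    exact hne ((orbit_eq_iff.2 h1).symm.trans (orbit_eq_iff.2 h2))
  have hcl₁ : IsClosed (orbit G w₁) := (orbit_compact hc w₁).isClosed
  have hcl₂ : IsClosed (orbit G w₂) := (orbit_compact hc w₂).isClosed
  have : CompactSpace K :=
    isCompact_iff_compactSpace.mp ((orbit_compact hc w₁).union (orbit_compact hc w₂))
  let S : StarSubalgebra ℂ C(K, ℂ) :=
    { carrier := {f | ∃ p ∈ polyAlg V, ∀ x : K, f x = p x}
      mul_mem' := by
        rintro a b ⟨p, hp, h⟩ ⟨q, hq, h'⟩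
        exact ⟨p * q, (polyAlg V).mul_mem hp hq, fun x => by simp [h, h']⟩
      add_mem' := by
        rintro a b ⟨p, hp, h⟩ ⟨q, hq, h'⟩
        exact ⟨p + q, (polyAlg V).add_mem hp hq, fun x => by simp [h, h']⟩
      algebraMap_mem' := fun c => ⟨_, const_mem_polyAlg c, fun x => rfl⟩
      star_mem' := by
        rintro a ⟨p, hp, h⟩
        obtain ⟨q, hq, h'⟩ := hconj p hp
        exact ⟨q, hq, fun x => by rw [h' x x.2, ← h]; rfl⟩ }
  have hsep : S.SeparatesPoints := by
    intro x y hxy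
    refine ⟨fun z => ⟪(x : V) - y, (z : V)⟫_ℂ, ⟨⟨fun z => ⟪(x : V) - y, (z : V)⟫_ℂ, by fun_prop⟩,
      ⟨_, inner_mem_polyAlg ((x : V) - y), fun z => rfl⟩, rfl⟩, ?_⟩
    intro heq
    apply hxy
    have : ⟪(x : V) - y, (x : V) - y⟫_ℂ = 0 := by
      rw [inner_sub_right, sub_eq_zero]; exact heq
    exact Subtype.ext (sub_eq_zero.1 (inner_self_eq_zero.1 this))
  have hdense := ContinuousMap.starSubalgebra_topologicalClosure_eq_top_of_separatesPoints S hsep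
  classical
  have hclop : IsClopen {x : K | (x : V) ∈ orbit G w₂} := by
    refine ⟨hcl₂.preimage continuous_subtype_val, ?_⟩
    have : {x : K | (x : V) ∈ orbit G w₂} = {x : K | (x : V) ∈ orbit G w₁}ᶜ := by
      ext x
      constructor
      · intro h h'
        exact hdisj _ h' h
      · intro h
        exact x.2.resolve_left h
    rw [this]
    exact (hcl₁.preimage continuous_subtype_val).isOpen_compl
  let χ : C(K, ℂ) := ⟨Set.indicator {x : K | (x : V) ∈ orbit G w₂} (fun _ => 1),
    continuous_const.indicator (by simp [hclop.frontier_eq])⟩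
  have hχ : χ ∈ closure (S : Set C(K, ℂ)) := by
    have : χ ∈ S.topologicalClosure := by rw [hdense]; trivial
    exact this
  obtain ⟨f, ⟨p, hp, hfp⟩, hdist⟩ := Metric.mem_closure_iff.1 hχ (1 / 4) (by norm_num)
  have happ : ∀ z (hz : z ∈ K), ‖χ ⟨z, hz⟩ - p z‖ ≤ 1 / 4 := by
    intro z hz
    rw [← hfp ⟨z, hz⟩, ← dist_eq_norm]
    exact (ContinuousMap.dist_apply_le_dist _).trans hdist.le
  have hpint : ∀ z, Integrable (fun g : G => p (g • z)) ν := fun z =>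
    integrable_cont ν ((polyAlg_continuous hp).comp (hc z))
  have hPpoly : (fun z => ∫ g : G, p (g • z) * 1 ∂ν) ∈ polyAlg V :=
    avg_mem ν hc hp (k := fun _ => 1) continuous_const
  simp only [mul_one] at hPpoly
  have hPinv : ∀ g : G, ∫ k : G, p (k • g • v) ∂ν = ∫ k : G, p (k • v) ∂ν := by
    intro g
    rw [← integral_mul_right_eq_self (fun k : G => p (k • v)) g]
    simp only [mul_smul]
  have e₁ := invariant_on_hull hc hw₁ hPpoly hPinv
  have e₂ := invariant_on_hull hc hw₂ hPpoly hPinv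
  have b₁ : ‖∫ g : G, p (g • w₁) ∂ν‖ ≤ 1 / 4 := by
    refine (norm_integral_le_of_norm_le_const (C := 1 / 4) (Filter.Eventually.of_forall
        fun g => ?_)).trans (by simp)
    have := happ (g • w₁) (Or.inl (mem_orbit w₁ g))
    have h0 : χ ⟨g • w₁, Or.inl (mem_orbit w₁ g)⟩ = 0 :=
      Set.indicator_of_notMem (s := {x : K | (x : V) ∈ orbit G w₂})
        (a := (⟨g • w₁, Or.inl (mem_orbit w₁ g)⟩ : K)) (hdisj _ (mem_orbit w₁ g)) (fun _ => (1 : ℂ))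
    rwa [h0, zero_sub, norm_neg] at this
  have b₂ : ‖∫ g : G, (1 - p (g • w₂)) ∂ν‖ ≤ 1 / 4 := by
    refine (norm_integral_le_of_norm_le_const (C := 1 / 4) (Filter.Eventually.of_forall
        fun g => ?_)).trans (by simp)
    have := happ (g • w₂) (Or.inr (mem_orbit w₂ g))
    have h0 : χ ⟨g • w₂, Or.inr (mem_orbit w₂ g)⟩ = 1 :=
      Set.indicator_of_mem (s := {x : K | (x : V) ∈ orbit G w₂})
        (a := (⟨g • w₂, Or.inr (mem_orbit w₂ g)⟩ : K)) (mem_orbit w₂ g) (fun _ => (1 : ℂ))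
    rwa [h0] at this
  rw [integral_sub (integrable_const _) (hpint w₂)] at b₂
  simp only [integral_const, probReal_univ, one_smul] at b₂
  have e₃ : ∫ g : G, p (g • w₁) ∂ν = ∫ g : G, p (g • w₂) ∂ν := e₁.trans e₂.symm
  rw [← e₃] at b₂
  have := norm_add_le (∫ g : G, p (g • w₁) ∂ν) (1 - ∫ g : G, p (g • w₁) ∂ν)
  rw [add_sub_cancel, norm_one] at this
  linarith

end Group

end Core

section Transfer

variable {V : Type*} [AddCommGroup V] [Module ℂ V] [FiniteDimensional ℂ V]
  {G : Type*} [Group G] [TopologicalSpace G] [IsTopologicalGroup G] [CompactSpace G]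
  [MeasurableSpace G] [BorelSpace G] [DistribMulAction G V] [SMulCommClass G ℂ V]

open scoped ComplexConjugate

/-- Averaging produces an invariant inner product. -/
lemma exists_inv_core (ν : Measure G) [ν.IsHaarMeasure] [ν.IsMulRightInvariant]
    (hc : ∀ (x : V) (l : V →ₗ[ℂ] ℂ), Continuous fun g : G => l (g • x)) :
    ∃ c : InnerProductSpace.Core ℂ V, ∀ (g : G) (x y : V),
      c.inner (g • x) (g • y) = c.inner x y := by
  let b := Module.finBasis ℂ V
  have hco : ∀ x y : V, Continuous fun g : G =>
      ∑ i, conj (b.coord i (g • x)) * b.coord i (g • y) := fun x y =>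
    continuous_finsetSum _ fun i _ =>
      (Complex.continuous_conj.comp (hc x (b.coord i))).mul (hc y (b.coord i))
  have hIntg : ∀ x y : V, Integrable (fun g : G =>
      ∑ i, conj (b.coord i (g • x)) * b.coord i (g • y)) ν := fun x y =>
    (hco x y).integrable_of_hasCompactSupport (HasCompactSupport.of_compactSpace _)
  have hsq : ∀ (x : V) (g : G), ∑ i, conj (b.coord i (g • x)) * b.coord i (g • x) =
      ((∑ i, ‖b.coord i (g • x)‖ ^ 2 : ℝ) : ℂ) := by
    intro x g
    rw [Complex.ofReal_sum]
    refine Finset.sum_congr rfl fun i _ => ?_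
    rw [mul_comm, Complex.mul_conj, Complex.normSq_eq_norm_sq]
  let B : V → V → ℂ := fun x y => ∫ g : G, ∑ i, conj (b.coord i (g • x)) * b.coord i (g • y) ∂ν
  have hBB : ∀ x, B x x = ((∫ g : G, ∑ i, ‖b.coord i (g • x)‖ ^ 2 ∂ν : ℝ) : ℂ) := by
    intro x
    simp only [B, hsq]
    rw [integral_complex_ofReal]
  let c : InnerProductSpace.Core ℂ V :=
    { inner := B
      conj_inner_symm := fun x y => by
        simp only [B]
        rw [← integral_conj]
        congr 1; ext g
        simp [mul_comm]
      re_inner_nonneg := fun x => by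
        change 0 ≤ RCLike.re (B x x)
        rw [hBB]
        simp only [RCLike.re_to_complex, Complex.ofReal_re]
        exact integral_nonneg fun g => by positivity
      add_left := fun x y z => by
        simp only [B]
        rw [← integral_add (hIntg x z) (hIntg y z)]
        congr 1; ext g
        rw [← Finset.sum_add_distrib]
        refine Finset.sum_congr rfl fun i _ => ?_
        rw [smul_add, map_add, map_add, add_mul]
      smul_left := fun x y r => by
        simp only [B]
        rw [← integral_const_mul]
        congr 1; ext g
        rw [Finset.mul_sum]
        refine Finset.sum_congr rfl fun i _ => ?_
        rw [smul_comm g r, map_smul, smul_eq_mul, map_mul, mul_assoc]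
      definite := fun x hx => by
        change B x x = 0 at hx
        rw [hBB, Complex.ofReal_eq_zero] at hx
        by_contra hx0
        have hcont : Continuous fun g : G => ∑ i, ‖b.coord i (g • x)‖ ^ 2 :=
          continuous_finsetSum _ fun i _ => (hc x (b.coord i)).norm.pow 2
        have hpos := hcont.integral_pos_of_hasCompactSupport_nonneg_nonzero (μ := ν)
          (HasCompactSupport.of_compactSpace _) (fun k => by positivity) (x := 1) (by
            intro h0
            apply hx0
            rw [Finset.sum_eq_zero_iff_of_nonneg (fun i _ => by positivity)] at h0
            apply b.ext_elem
            intro i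
            have := h0 i (Finset.mem_univ i)
            simpa using this)
        exact hpos.ne' hx }
  refine ⟨c, fun g x y => ?_⟩
  change B (g • x) (g • y) = B x y
  simp only [B]
  rw [← integral_mul_right_eq_self
    (fun k : G => ∑ i, conj (b.coord i (k • x)) * b.coord i (k • y)) g]
  simp only [mul_smul]

lemma transfer_main (ν : Measure G) [ν.IsHaarMeasure] [IsProbabilityMeasure ν]
    [ν.IsMulRightInvariant]
    (hc : ∀ (x : V) (l : V →ₗ[ℂ] ℂ), Continuous fun g : G => l (g • x)) (v : V)
    (hG : IsGelfandPair ν (stabilizer G v)) :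
    (∃ w ∈ pHull (orbit G v), orbit G w ⊆ pHull (orbit G v) ∧ pHull (orbit G w) = orbit G w) ∧
    ∀ w₁ ∈ pHull (orbit G v), ∀ w₂ ∈ pHull (orbit G v),
      pHull (orbit G w₁) = orbit G w₁ → pHull (orbit G w₂) = orbit G w₂ →
      orbit G w₁ = orbit G w₂ := by
  obtain ⟨c, hcinv⟩ := exists_inv_core ν hc
  letI : NormedAddCommGroup V := c.toNormedAddCommGroup
  letI : InnerProductSpace ℂ V := InnerProductSpace.ofCore c.toCore
  have hc' : ∀ x : V, Continuous fun g : G => g • x := by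
    intro x
    let b := Module.finBasis ℂ V
    have : (fun g : G => g • x) = fun g : G => ∑ i, b.coord i (g • x) • b i := by
      ext g
      exact (b.sum_repr (g • x)).symm
    rw [this]
    exact continuous_finsetSum _ fun i _ => (hc x (b.coord i)).smul continuous_const
  exact ⟨exists_convex_orbit hc' hcinv v, fun w₁ h₁ w₂ h₂ k₁ k₂ =>
    unique_convex_orbit ν hc' hcinv hG h₁ h₂ k₁ k₂⟩

end Transfer

/-- Let `G` be a compact connected subgroup of `GL(V)` and `M = G·v` a commutative
orbit.  Then the polynomially convex hull `M̂` of `M` contains exactly one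
polynomially convex `G`-orbit. -/
theorem hull_contains_unique_polynomially_convex_orbit
    {V : Type*} [NormedAddCommGroup V] [NormedSpace ℂ V] [FiniteDimensional ℂ V]
    (G : Subgroup (V →L[ℂ] V)ˣ)
    (hGcpt : IsCompact (G : Set (V →L[ℂ] V)ˣ))
    (hGconn : IsConnected (G : Set (V →L[ℂ] V)ˣ))
    (v : V)
    [MeasurableSpace G] [BorelSpace G]
    (ν : Measure G) [ν.IsHaarMeasure] [IsProbabilityMeasure ν]
    (hGelfand : IsGelfandPair ν (stabilizer G v)) :
    (∃ w ∈ polyHull (orbit G v),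
      orbit G w ⊆ polyHull (orbit G v) ∧ polyHull (orbit G w) = orbit G w) ∧
    ∀ w₁ ∈ polyHull (orbit G v), ∀ w₂ ∈ polyHull (orbit G v),
      polyHull (orbit G w₁) = orbit G w₁ → polyHull (orbit G w₂) = orbit G w₂ →
      orbit G w₁ = orbit G w₂ := by
  have : CompactSpace G := isCompact_iff_compactSpace.mp hGcpt
  have : ν.IsMulRightInvariant := by
    refine ⟨fun g => ?_⟩
    have h1 : IsProbabilityMeasure (Measure.map (· * g) ν) :=
      Measure.isProbabilityMeasure_map (measurable_mul_const g).aemeasurable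
    exact Measure.isHaarMeasure_eq_of_isProbabilityMeasure _ _
  refine transfer_main ν ?_ v hGelfand
  intro x l
  refine l.continuous_of_finiteDimensional.comp ?_
  change Continuous fun g : G => ((g : (V →L[ℂ] V)ˣ) : V →L[ℂ] V) x
  exact (Units.continuous_val.comp continuous_subtype_val).clm_apply continuous_const
end
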